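/- For every integer n ≥ 1, the following identity holds in ℤ[p,q,t]: Σ_{σ∈S_n} p^{nest σ} q^{cros σ} t^{wex σ} = Σ_{k=0}^{⌊(n−1)/2⌋} a_{n,k}(p,q) · t^{k+1} · (1+t)^{n−1−2k}. -/

import Mathlib

open scoped Classical
open Finset

noncomputable section

namespace SZpaper

/-- `σ` as a 1-indexed function on `[1,n]`, extended by `0` elsewhere
(boundary convention `σ(0)=σ(n+1)=0`). -/
def pext (n : ℕ) (σ : Equiv.Perm (Fin n)) (i : ℕ) : ℕ :=
  if h : 1 ≤ i ∧ i ≤ n then ((σ ⟨i - 1, by omega⟩ : Fin n) : ℕ) + 1 else 0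

/-- `σ` extended with the Brändén boundary convention `σ(0)=σ(n+1)=n+1`. -/
def pextB (n : ℕ) (σ : Equiv.Perm (Fin n)) (i : ℕ) : ℕ :=
  if h : 1 ≤ i ∧ i ≤ n then ((σ ⟨i - 1, by omega⟩ : Fin n) : ℕ) + 1 else n + 1

/-- `σ` extended with the boundary convention `σ(0)=0`, `σ(n+1)=n+1`. -/
def pextC (n : ℕ) (σ : Equiv.Perm (Fin n)) (i : ℕ) : ℕ :=
  if h : 1 ≤ i ∧ i ≤ n then ((σ ⟨i - 1, by omega⟩ : Fin n) : ℕ) + 1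
  else if i = 0 then 0 else n + 1

/-- The set of pairs `(i,j)` with `i, j ∈ [1,n]`. -/
def pairs (n : ℕ) : Finset (ℕ × ℕ) := Finset.Icc 1 n ×ˢ Finset.Icc 1 n

/-- `des σ = #{i ∈ [n−1] : σ(i) > σ(i+1)}`. -/
def desStat (n : ℕ) (σ : Equiv.Perm (Fin n)) : ℕ :=
  ((Finset.Icc 1 (n - 1)).filter fun i => pext n σ (i + 1) < pext n σ i).card

/-- `les σ = #{(i,j) : 2 ≤ i < j ≤ n, σ(i−1) > σ(j) > σ(i)}`. -/
def lesStat (n : ℕ) (σ : Equiv.Perm (Fin n)) : ℕ :=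
  ((pairs n).filter fun x => 2 ≤ x.1 ∧ x.1 < x.2 ∧
    pext n σ x.1 < pext n σ x.2 ∧ pext n σ x.2 < pext n σ (x.1 - 1)).card

/-- `less σ = #{(i,j) : 2 ≤ i < j ≤ n, σ(i−1) < σ(j) < σ(i)}`. -/
def lessStat (n : ℕ) (σ : Equiv.Perm (Fin n)) : ℕ :=
  ((pairs n).filter fun x => 2 ≤ x.1 ∧ x.1 < x.2 ∧
    pext n σ (x.1 - 1) < pext n σ x.2 ∧ pext n σ x.2 < pext n σ x.1).card

/-- `res σ = #{(i,j) : 1 ≤ i < j ≤ n−1, σ(j+1) > σ(i) > σ(j)}`. -/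
def resStat (n : ℕ) (σ : Equiv.Perm (Fin n)) : ℕ :=
  ((pairs n).filter fun x => x.1 < x.2 ∧ x.2 ≤ n - 1 ∧
    pext n σ x.2 < pext n σ x.1 ∧ pext n σ x.1 < pext n σ (x.2 + 1)).card

/-- `ress σ = #{(i,j) : 1 ≤ i < j ≤ n−1, σ(j+1) < σ(i) < σ(j)}`. -/
def ressStat (n : ℕ) (σ : Equiv.Perm (Fin n)) : ℕ :=
  ((pairs n).filter fun x => x.1 < x.2 ∧ x.2 ≤ n - 1 ∧
    pext n σ (x.2 + 1) < pext n σ x.1 ∧ pext n σ x.1 < pext n σ x.2).card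

/-! Linear statistics with the boundary convention `σ(0)=σ(n+1)=0` (starred). -/

def peakStar (n : ℕ) (σ : Equiv.Perm (Fin n)) : ℕ :=
  ((Finset.Icc 1 n).filter fun i =>
    pext n σ (i - 1) < pext n σ i ∧ pext n σ (i + 1) < pext n σ i).card

def valleyStar (n : ℕ) (σ : Equiv.Perm (Fin n)) : ℕ :=
  ((Finset.Icc 1 n).filter fun i =>
    pext n σ i < pext n σ (i - 1) ∧ pext n σ i < pext n σ (i + 1)).card

def daStar (n : ℕ) (σ : Equiv.Perm (Fin n)) : ℕ :=
  ((Finset.Icc 1 n).filter fun i =>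
    pext n σ (i - 1) < pext n σ i ∧ pext n σ i < pext n σ (i + 1)).card

def ddStar (n : ℕ) (σ : Equiv.Perm (Fin n)) : ℕ :=
  ((Finset.Icc 1 n).filter fun i =>
    pext n σ (i + 1) < pext n σ i ∧ pext n σ i < pext n σ (i - 1)).card

/-! Linear statistics with the Brändén boundary convention `σ(0)=σ(n+1)=n+1`. -/

def peakB (n : ℕ) (σ : Equiv.Perm (Fin n)) : ℕ :=
  ((Finset.Icc 1 n).filter fun i =>
    pextB n σ (i - 1) < pextB n σ i ∧ pextB n σ (i + 1) < pextB n σ i).card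

def valleyB (n : ℕ) (σ : Equiv.Perm (Fin n)) : ℕ :=
  ((Finset.Icc 1 n).filter fun i =>
    pextB n σ i < pextB n σ (i - 1) ∧ pextB n σ i < pextB n σ (i + 1)).card

def daB (n : ℕ) (σ : Equiv.Perm (Fin n)) : ℕ :=
  ((Finset.Icc 1 n).filter fun i =>
    pextB n σ (i - 1) < pextB n σ i ∧ pextB n σ i < pextB n σ (i + 1)).card

def ddB (n : ℕ) (σ : Equiv.Perm (Fin n)) : ℕ :=
  ((Finset.Icc 1 n).filter fun i =>
    pextB n σ (i + 1) < pextB n σ i ∧ pextB n σ i < pextB n σ (i - 1)).card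

/-! Linear statistics with the boundary convention `σ(0)=0`, `σ(n+1)=n+1`. -/

def valleyC (n : ℕ) (σ : Equiv.Perm (Fin n)) : ℕ :=
  ((Finset.Icc 1 n).filter fun i =>
    pextC n σ i < pextC n σ (i - 1) ∧ pextC n σ i < pextC n σ (i + 1)).card

def daC (n : ℕ) (σ : Equiv.Perm (Fin n)) : ℕ :=
  ((Finset.Icc 1 n).filter fun i =>
    pextC n σ (i - 1) < pextC n σ i ∧ pextC n σ i < pextC n σ (i + 1)).card

def ddC (n : ℕ) (σ : Equiv.Perm (Fin n)) : ℕ :=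
  ((Finset.Icc 1 n).filter fun i =>
    pextC n σ (i + 1) < pextC n σ i ∧ pextC n σ i < pextC n σ (i - 1)).card

/-- `fmax σ`: the number of double ascents (convention `σ(0)=0`, `σ(n+1)=n+1`)
which are left-to-right maxima. -/
def fmaxStat (n : ℕ) (σ : Equiv.Perm (Fin n)) : ℕ :=
  ((Finset.Icc 1 n).filter fun i =>
    pextC n σ (i - 1) < pextC n σ i ∧ pextC n σ i < pextC n σ (i + 1) ∧
    ∀ j ∈ Finset.Ico 1 i, pext n σ j < pext n σ i).card

/-! Cyclic statistics. -/

def excStat (n : ℕ) (σ : Equiv.Perm (Fin n)) : ℕ :=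
  ((Finset.Icc 1 n).filter fun i => i < pext n σ i).card

def wexStat (n : ℕ) (σ : Equiv.Perm (Fin n)) : ℕ :=
  ((Finset.Icc 1 n).filter fun i => i ≤ pext n σ i).card

def dropStat (n : ℕ) (σ : Equiv.Perm (Fin n)) : ℕ :=
  ((Finset.Icc 1 n).filter fun i => pext n σ i < i).card

def fixStat (n : ℕ) (σ : Equiv.Perm (Fin n)) : ℕ :=
  ((Finset.Icc 1 n).filter fun i => pext n σ i = i).card

/-- cyclic valleys: `x` with `σ⁻¹(x) > x < σ(x)`. -/
def cvalleyStat (n : ℕ) (σ : Equiv.Perm (Fin n)) : ℕ :=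
  ((Finset.Icc 1 n).filter fun x => x < pext n σ⁻¹ x ∧ x < pext n σ x).card

/-- double excedances: `x` with `σ⁻¹(x) < x < σ(x)`. -/
def cdaStat (n : ℕ) (σ : Equiv.Perm (Fin n)) : ℕ :=
  ((Finset.Icc 1 n).filter fun x => pext n σ⁻¹ x < x ∧ x < pext n σ x).card

/-- double drops: `x` with `σ⁻¹(x) > x > σ(x)`. -/
def cddStat (n : ℕ) (σ : Equiv.Perm (Fin n)) : ℕ :=
  ((Finset.Icc 1 n).filter fun x => x < pext n σ⁻¹ x ∧ pext n σ x < x).card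

/-- crossings. -/
def crosStat (n : ℕ) (σ : Equiv.Perm (Fin n)) : ℕ :=
  ((pairs n).filter fun x =>
    (x.1 < x.2 ∧ x.2 ≤ pext n σ x.1 ∧ pext n σ x.1 < pext n σ x.2) ∨
    (x.2 < x.1 ∧ pext n σ x.1 < x.2 ∧ pext n σ x.2 < pext n σ x.1)).card

/-- nestings. -/
def nestStat (n : ℕ) (σ : Equiv.Perm (Fin n)) : ℕ :=
  ((pairs n).filter fun x =>
    (x.1 < x.2 ∧ x.2 ≤ pext n σ x.2 ∧ pext n σ x.2 < pext n σ x.1) ∨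
    (x.2 < x.1 ∧ pext n σ x.2 < x.2 ∧ pext n σ x.1 < pext n σ x.2)).card

/-- number of cycles of `σ` (fixed points count as cycles). -/
def cycStat (n : ℕ) (σ : Equiv.Perm (Fin n)) : ℕ :=
  Multiset.card σ.cycleType + (Finset.univ.filter fun x => σ x = x).card

/-! Star statistics: `σ*(i) = σ(i) − 1`, a bijection `[n] → {0,…,n−1}`;
we extend `σ*` by `0` outside `[1,n]`. -/

def starf (n : ℕ) (σ : Equiv.Perm (Fin n)) (i : ℕ) : ℕ :=
  if 1 ≤ i ∧ i ≤ n then pext n σ i - 1 else 0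

/-- `(σ*)⁻¹(i) = σ⁻¹(i+1)`, defined for `0 ≤ i ≤ n−1`. -/
def invstarf (n : ℕ) (σ : Equiv.Perm (Fin n)) (i : ℕ) : ℕ :=
  pext n σ⁻¹ (i + 1)

def dropStarStat (n : ℕ) (σ : Equiv.Perm (Fin n)) : ℕ :=
  ((Finset.Icc 1 n).filter fun i => starf n σ i < i).card

def fixStarStat (n : ℕ) (σ : Equiv.Perm (Fin n)) : ℕ :=
  ((Finset.Icc 1 n).filter fun i => starf n σ i = i).card

def wexStarStat (n : ℕ) (σ : Equiv.Perm (Fin n)) : ℕ :=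
  ((Finset.Icc 1 n).filter fun i => i ≤ starf n σ i).card

def cdaStarStat (n : ℕ) (σ : Equiv.Perm (Fin n)) : ℕ :=
  ((Finset.Icc 1 n).filter fun i => invstarf n σ i < i ∧ i < starf n σ i).card

def cddStarStat (n : ℕ) (σ : Equiv.Perm (Fin n)) : ℕ :=
  ((Finset.Icc 1 n).filter fun i => i < invstarf n σ i ∧ starf n σ i < i).card

def cvalleyStarStat (n : ℕ) (σ : Equiv.Perm (Fin n)) : ℕ :=
  ((Finset.Icc 1 n).filter fun i => i < invstarf n σ i ∧ i < starf n σ i).card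

def crosStarStat (n : ℕ) (σ : Equiv.Perm (Fin n)) : ℕ :=
  ((pairs n).filter fun x =>
    (x.1 < x.2 ∧ x.2 ≤ starf n σ x.1 ∧ starf n σ x.1 < starf n σ x.2) ∨
    (x.2 < x.1 ∧ starf n σ x.1 < x.2 ∧ starf n σ x.2 < starf n σ x.1)).card

def nestStarStat (n : ℕ) (σ : Equiv.Perm (Fin n)) : ℕ :=
  ((pairs n).filter fun x =>
    (x.1 < x.2 ∧ x.2 ≤ starf n σ x.2 ∧ starf n σ x.2 < starf n σ x.1) ∨
    (x.2 < x.1 ∧ starf n σ x.2 < x.2 ∧ starf n σ x.1 < starf n σ x.2)).card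

/-- `cyc* σ`: the number of cycles of the functional digraph of `σ*` on `[n]`,
counted as the number of `i ∈ [1,n]` that lie on a cycle of `σ*` and are
minimal in their cycle. (The component of `σ*` that is a path from `n` to `0`
contributes no such `i`.) -/
def cycStarStat (n : ℕ) (σ : Equiv.Perm (Fin n)) : ℕ :=
  ((Finset.Icc 1 n).filter fun i =>
    (∃ m ∈ Finset.Icc 1 n, (starf n σ)^[m] i = i) ∧
    ∀ m ∈ Finset.range (n + 1), i ≤ (starf n σ)^[m] i).card

/-! Motzkin paths, encoded as step sequences `γ : Fin m → Fin 3`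
(`0` = up step `(1,1)`, `1` = level step `(1,0)`, `2` = down step `(1,−1)`). -/

/-- The height (ordinate) of the path after `i` steps. -/
def hgt (m : ℕ) (γ : Fin m → Fin 3) (i : ℕ) : ℤ :=
  ∑ j ∈ Finset.range i, if hj : j < m then 1 - ((γ ⟨j, hj⟩ : ℕ) : ℤ) else 0

/-- A step sequence is a Motzkin path if it never goes below the x-axis and
ends at height `0`. -/
def IsMotzkin (m : ℕ) (γ : Fin m → Fin 3) : Prop :=
  (∀ i ≤ m, 0 ≤ hgt m γ i) ∧ hgt m γ m = 0

/-- The (finite) set of Motzkin paths of length `m`. -/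
def motzkin (m : ℕ) : Finset (Fin m → Fin 3) :=
  Finset.univ.filter fun γ => IsMotzkin m γ

/-- number of up (North-East) steps. -/
def neCount (m : ℕ) (γ : Fin m → Fin 3) : ℕ :=
  (Finset.univ.filter fun i => γ i = 0).card

/-- number of level (East) steps. -/
def eCount (m : ℕ) (γ : Fin m → Fin 3) : ℕ :=
  (Finset.univ.filter fun i => γ i = 1).card

/-- the `(p,q)`-integer `[m]_{p,q} = p^{m−1} + p^{m−2}q + ⋯ + q^{m−1}`. -/
def pqInt {R : Type*} [CommRing R] (p q : R) (m : ℕ) : R :=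
  ∑ j ∈ Finset.range m, p ^ (m - 1 - j) * q ^ j

open MvPolynomial in
/-- `a_{n,k}(p,q)` (with `p = X 0`, `q = X 1`), as an element of `ℤ[p,q,t]`. -/
def aPoly3t (n k : ℕ) : MvPolynomial (Fin 3) ℤ :=
  ∑ σ ∈ Finset.univ.filter
      (fun σ : Equiv.Perm (Fin n) => valleyStar n σ = k ∧ ddStar n σ = 0),
    X 0 ^ resStat n σ * X 1 ^ lesStat n σ

/-- The permutation obtained from `σ` by inserting a new row `r` and a new column `c`
with `r ↦ c`. -/
def insPerm {n : ℕ} (r c : Fin (n + 1)) (σ : Equiv.Perm (Fin n)) : Equiv.Perm (Fin (n + 1)) :=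
  (finSuccEquiv' r).trans ((Equiv.optionCongr σ).trans (finSuccEquiv' c).symm)

lemma insPerm_self {n : ℕ} (r c : Fin (n + 1)) (σ : Equiv.Perm (Fin n)) :
    insPerm r c σ r = c := by
  simp [insPerm]

lemma insPerm_succAbove {n : ℕ} (r c : Fin (n + 1)) (σ : Equiv.Perm (Fin n)) (i : Fin n) :
    insPerm r c σ (r.succAbove i) = c.succAbove (σ i) := by
  simp [insPerm]

lemma insPerm_injective {n : ℕ} (r c : Fin (n + 1)) : Function.Injective (insPerm r c) := by
  intro σ τ h
  ext i
  have := congrArg (fun f => f (r.succAbove i)) h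
  simp only [insPerm_succAbove] at this
  rw [Fin.succAbove_right_injective this]

lemma exists_insPerm {n : ℕ} {r c : Fin (n + 1)} {τ : Equiv.Perm (Fin (n + 1))} (h : τ r = c) :
    ∃ σ, insPerm r c σ = τ := by
  refine ⟨Equiv.removeNone ((finSuccEquiv' r).symm.trans (τ.trans (finSuccEquiv' c))), ?_⟩
  have : Equiv.optionCongr
      (Equiv.removeNone ((finSuccEquiv' r).symm.trans (τ.trans (finSuccEquiv' c)))) =
      (finSuccEquiv' r).symm.trans (τ.trans (finSuccEquiv' c)) := by
    ext1 x
    cases x with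
    | none => simp [h]
    | some x =>
      refine Equiv.removeNone_some _ (Option.ne_none_iff_exists'.1 fun hx => ?_)
      have hx' : τ (r.succAbove x) = c :=
        (finSuccEquiv'_eq_none.1 (by simpa using hx)).symm
      exact Fin.succAbove_ne r x (τ.injective (hx'.trans h.symm))
  rw [insPerm, this]
  ext x
  simp

lemma sum_perm_apply_eq {R : Type*} [AddCommMonoid R] {n : ℕ} (r c : Fin (n + 1))
    (f : Equiv.Perm (Fin (n + 1)) → R) :
    (∑ τ, if τ r = c then f τ else 0) = ∑ σ, f (insPerm r c σ) := by
  rw [← Finset.sum_filter]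
  symm
  refine Finset.sum_bij (fun σ _ => insPerm r c σ) ?_ ?_ ?_ ?_
  · intro σ _
    simp [insPerm_self]
  · intro σ _ τ _ h
    exact insPerm_injective r c h
  · intro τ hτ
    obtain ⟨σ, hσ⟩ := exists_insPerm (Finset.mem_filter.1 hτ).2
    exact ⟨σ, Finset.mem_univ _, hσ⟩
  · intros
    rfl

lemma val_succAbove {n : ℕ} (r : Fin (n + 1)) (i : Fin n) :
    (r.succAbove i : ℕ) = if (i : ℕ) < r then (i : ℕ) else i + 1 := by
  rw [Fin.succAbove]
  split_ifs <;> simp_all [Fin.lt_def]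

/-- The arcs `x ↦ X` and `y ↦ Y` are nested. -/
def NestRel (x y X Y : ℕ) : Prop := (x < y ∧ y ≤ Y ∧ Y < X) ∨ (y < x ∧ Y < y ∧ X < Y)

/-- The arcs `x ↦ X` and `y ↦ Y` are crossing. -/
def CrosRel (x y X Y : ℕ) : Prop := (x < y ∧ y ≤ X ∧ X < Y) ∨ (y < x ∧ X < y ∧ Y < X)

lemma sum_Icc_one {M : Type*} [AddCommMonoid M] (n : ℕ) (f : ℕ → M) :
    ∑ i ∈ Finset.Icc 1 n, f i = ∑ i : Fin n, f (i + 1) := by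
  rw [Fin.sum_univ_eq_sum_range (fun i => f (i + 1)), Finset.range_eq_Ico,
    Finset.sum_Ico_add' f 0 n 1]
  rfl

lemma pext_succ {n : ℕ} (σ : Equiv.Perm (Fin n)) (i : Fin n) :
    pext n σ (i + 1) = σ i + 1 := by
  simp [pext]

lemma nestStat_eq {n : ℕ} (σ : Equiv.Perm (Fin n)) :
    nestStat n σ = ∑ x : Fin n, ∑ y : Fin n, if NestRel x y (σ x) (σ y) then 1 else 0 := by
  simp [nestStat, pairs, Finset.card_filter, Finset.sum_product, sum_Icc_one, pext_succ, NestRel,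
    -Finset.sum_boole]

lemma crosStat_eq {n : ℕ} (σ : Equiv.Perm (Fin n)) :
    crosStat n σ = ∑ x : Fin n, ∑ y : Fin n, if CrosRel x y (σ x) (σ y) then 1 else 0 := by
  simp [crosStat, pairs, Finset.card_filter, Finset.sum_product, sum_Icc_one, pext_succ, CrosRel,
    -Finset.sum_boole]

lemma wexStat_eq {n : ℕ} (σ : Equiv.Perm (Fin n)) :
    wexStat n σ = ∑ x : Fin n, if (x : ℕ) ≤ σ x then 1 else 0 := by
  simp [wexStat, Finset.card_filter, sum_Icc_one, pext_succ, -Finset.sum_boole]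

/-- Every row below `u` is sent to a column which is at least `v`. -/
def HighRows {n : ℕ} (u v : ℕ) (σ : Equiv.Perm (Fin n)) : Prop :=
  ∀ i : Fin n, (i : ℕ) < u → v ≤ σ i

lemma sum_pairs_succAbove {n : ℕ} (r : Fin (n + 1)) (f : Fin (n + 1) → Fin (n + 1) → ℕ) :
    ∑ x, ∑ y, f x y = f r r + ∑ y, f r (r.succAbove y) + ∑ x, f (r.succAbove x) r +
      ∑ x, ∑ y, f (r.succAbove x) (r.succAbove y) := by
  simp only [Fin.sum_univ_succAbove _ r, Finset.sum_add_distrib]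
  ring

lemma sum_interval {n : ℕ} (a b : ℕ) (hb : b ≤ n) (P : Fin n → Prop)
    (hP : ∀ i : Fin n, P i ↔ a ≤ i ∧ (i : ℕ) < b) :
    (∑ i : Fin n, if P i then 1 else 0) = b - a := by
  simp only [hP]
  rw [Fin.sum_univ_eq_sum_range (fun i => if a ≤ i ∧ i < b then 1 else 0), ← Finset.card_filter]
  have : (Finset.range n).filter (fun i => a ≤ i ∧ i < b) = Finset.Ico a b := by
    ext i
    simp
    omega
  rw [this, Nat.card_Ico]

section Upper

variable {n : ℕ} {r c : Fin (n + 1)} {σ : Equiv.Perm (Fin n)}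

lemma nestStat_insPerm_upper (hr : r ≤ c) (h : HighRows c c σ) :
    nestStat (n + 1) (insPerm r c σ) = nestStat n σ + r := by
  rw [nestStat_eq, nestStat_eq, sum_pairs_succAbove r]
  simp only [insPerm_self, insPerm_succAbove, val_succAbove]
  rw [Fin.le_def] at hr
  have h1 : (∑ y : Fin n, if NestRel r (if (y : ℕ) < r then (y : ℕ) else y + 1) c
      (if (σ y : ℕ) < c then (σ y : ℕ) else σ y + 1) then 1 else 0) = 0 - 0 := by
    refine sum_interval 0 0 (Nat.zero_le _) _ fun y => ?_
    have := h y
    unfold NestRel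
    split_ifs <;> omega
  have h2 : (∑ x : Fin n, if NestRel (if (x : ℕ) < r then (x : ℕ) else x + 1) r
      (if (σ x : ℕ) < c then (σ x : ℕ) else σ x + 1) c then 1 else 0) = (r : ℕ) - 0 := by
    refine sum_interval 0 r (by omega) _ fun y => ?_
    have := h y
    unfold NestRel
    split_ifs <;> omega
  rw [h1, h2, add_comm]
  congr 1
  · refine Finset.sum_congr rfl fun x _ => Finset.sum_congr rfl fun y _ => ?_
    have hx := h x
    have hy := h y
    refine if_congr ?_ rfl rfl
    unfold NestRel
    split_ifs <;> omega
  · simp [NestRel]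

lemma crosStat_insPerm_upper (hr : r ≤ c) (h : HighRows c c σ) :
    crosStat (n + 1) (insPerm r c σ) = crosStat n σ + (c - r) := by
  rw [crosStat_eq, crosStat_eq, sum_pairs_succAbove r]
  simp only [insPerm_self, insPerm_succAbove, val_succAbove]
  rw [Fin.le_def] at hr
  have h1 : (∑ y : Fin n, if CrosRel r (if (y : ℕ) < r then (y : ℕ) else y + 1) c
      (if (σ y : ℕ) < c then (σ y : ℕ) else σ y + 1) then 1 else 0) = (c : ℕ) - r := by
    refine sum_interval r c (by omega) _ fun y => ?_
    have := h y
    unfold CrosRel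
    split_ifs <;> omega
  have h2 : (∑ x : Fin n, if CrosRel (if (x : ℕ) < r then (x : ℕ) else x + 1) r
      (if (σ x : ℕ) < c then (σ x : ℕ) else σ x + 1) c then 1 else 0) = 0 - 0 := by
    refine sum_interval 0 0 (Nat.zero_le _) _ fun y => ?_
    have := h y
    unfold CrosRel
    split_ifs <;> omega
  rw [h1, h2, add_comm]
  congr 1
  · refine Finset.sum_congr rfl fun x _ => Finset.sum_congr rfl fun y _ => ?_
    have hx := h x
    have hy := h y
    refine if_congr ?_ rfl rfl
    unfold CrosRel
    split_ifs <;> omega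
  · simp [CrosRel]

lemma wexStat_insPerm_upper (hr : r ≤ c) (h : HighRows c c σ) :
    wexStat (n + 1) (insPerm r c σ) = wexStat n σ + 1 := by
  rw [wexStat_eq, wexStat_eq, Fin.sum_univ_succAbove _ r, insPerm_self,
    if_pos (by simpa using hr), add_comm]
  rw [Fin.le_def] at hr
  congr 1
  refine Finset.sum_congr rfl fun x _ => if_congr ?_ rfl rfl
  rw [insPerm_succAbove, val_succAbove, val_succAbove]
  have := h x
  split_ifs <;> omega

lemma highRows_insPerm_upper (hr : r ≤ c) :
    HighRows (c + 1) c (insPerm r c σ) ↔ HighRows c c σ := by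
  rw [Fin.le_def] at hr
  unfold HighRows
  rw [Fin.forall_iff_succAbove r]
  simp only [insPerm_self, insPerm_succAbove, val_succAbove]
  constructor
  · intro h i hi
    have := h.2 i
    split_ifs at this <;> omega
  · refine fun h => ⟨fun _ => le_rfl, fun i hi => ?_⟩
    have := h i
    split_ifs at * <;> omega

end Upper

section Lower

variable {n : ℕ} {r c : Fin (n + 1)} {σ : Equiv.Perm (Fin n)}

lemma sum_interval_perm (a b : ℕ) (hb : b ≤ n) (P : Fin n → Prop)
    (hP : ∀ i : Fin n, P i ↔ a ≤ σ i ∧ (σ i : ℕ) < b) :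
    (∑ i : Fin n, if P i then 1 else 0) = b - a := by
  rw [← Equiv.sum_comp σ⁻¹]
  refine sum_interval a b hb _ fun i => ?_
  simp [hP]

lemma nestStat_insPerm_lower (hr : c < r) (h : HighRows r (r - 1) σ) :
    nestStat (n + 1) (insPerm r c σ) = nestStat n σ + c := by
  rw [nestStat_eq, nestStat_eq, sum_pairs_succAbove r]
  simp only [insPerm_self, insPerm_succAbove, val_succAbove]
  rw [Fin.lt_def] at hr
  have h1 : (∑ y : Fin n, if NestRel r (if (y : ℕ) < r then (y : ℕ) else y + 1) c
      (if (σ y : ℕ) < c then (σ y : ℕ) else σ y + 1) then 1 else 0) = 0 - 0 := by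
    refine sum_interval 0 0 (Nat.zero_le _) _ fun y => ?_
    have := h y
    unfold NestRel
    split_ifs <;> omega
  have h2 : (∑ x : Fin n, if NestRel (if (x : ℕ) < r then (x : ℕ) else x + 1) r
      (if (σ x : ℕ) < c then (σ x : ℕ) else σ x + 1) c then 1 else 0) = (c : ℕ) - 0 := by
    refine sum_interval_perm (σ := σ) 0 c (by omega) _ fun y => ?_
    have := h y
    unfold NestRel
    split_ifs <;> omega
  rw [h1, h2, add_comm]
  congr 1
  · refine Finset.sum_congr rfl fun x _ => Finset.sum_congr rfl fun y _ => ?_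
    have hx := h x
    have hy := h y
    refine if_congr ?_ rfl rfl
    unfold NestRel
    split_ifs <;> omega
  · simp [NestRel]

lemma crosStat_insPerm_lower (hr : c < r) (h : HighRows r (r - 1) σ) :
    crosStat (n + 1) (insPerm r c σ) = crosStat n σ + (r - 1 - c) := by
  rw [crosStat_eq, crosStat_eq, sum_pairs_succAbove r]
  simp only [insPerm_self, insPerm_succAbove, val_succAbove]
  rw [Fin.lt_def] at hr
  have h1 : (∑ y : Fin n, if CrosRel r (if (y : ℕ) < r then (y : ℕ) else y + 1) c
      (if (σ y : ℕ) < c then (σ y : ℕ) else σ y + 1) then 1 else 0) = 0 - 0 := by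
    refine sum_interval 0 0 (Nat.zero_le _) _ fun y => ?_
    have := h y
    unfold CrosRel
    split_ifs <;> omega
  have h2 : (∑ x : Fin n, if CrosRel (if (x : ℕ) < r then (x : ℕ) else x + 1) r
      (if (σ x : ℕ) < c then (σ x : ℕ) else σ x + 1) c then 1 else 0) = (r - 1 : ℕ) - c := by
    refine sum_interval_perm (σ := σ) c (r - 1) (by omega) _ fun y => ?_
    have := h y
    unfold CrosRel
    split_ifs <;> omega
  rw [h1, h2, add_comm]
  congr 1
  · refine Finset.sum_congr rfl fun x _ => Finset.sum_congr rfl fun y _ => ?_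
    have hx := h x
    have hy := h y
    refine if_congr ?_ rfl rfl
    unfold CrosRel
    split_ifs <;> omega
  · simp [CrosRel]

lemma wexStat_insPerm_lower (hr : c < r) (h : HighRows r (r - 1) σ) :
    wexStat (n + 1) (insPerm r c σ) = wexStat n σ := by
  rw [wexStat_eq, wexStat_eq, Fin.sum_univ_succAbove _ r, insPerm_self,
    if_neg (by simpa using hr), zero_add]
  rw [Fin.lt_def] at hr
  refine Finset.sum_congr rfl fun x _ => if_congr ?_ rfl rfl
  rw [insPerm_succAbove, val_succAbove, val_succAbove]
  have := h x
  split_ifs <;> omega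

lemma highRows_insPerm_lower (hr : c < r) :
    HighRows r r (insPerm r c σ) ↔ HighRows r (r - 1) σ := by
  rw [Fin.lt_def] at hr
  unfold HighRows
  rw [Fin.forall_iff_succAbove r]
  simp only [insPerm_self, insPerm_succAbove, val_succAbove]
  constructor
  · intro h i hi
    have := h.2 i
    split_ifs at this <;> omega
  · refine fun h => ⟨fun h => absurd h (lt_irrefl _), fun i hi => ?_⟩
    have := h i
    split_ifs at * <;> omega

end Lower

section CyclicRecursion

variable {R : Type*} [CommRing R] (p q t : R)

/-- The generating function of the permutations of `[n]` with high rows with respect to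
nestings, crossings and weak excedances. -/
def highSum (u v n : ℕ) : R :=
  ∑ σ : Equiv.Perm (Fin n),
    if HighRows u v σ then p ^ nestStat n σ * q ^ crosStat n σ * t ^ wexStat n σ else 0

lemma pqInt_eq_sum_range (m : ℕ) :
    pqInt p q m = ∑ j ∈ Finset.range m, p ^ j * q ^ (m - 1 - j) := by
  rw [pqInt, ← Finset.sum_range_reflect]
  refine Finset.sum_congr rfl fun j hj => ?_
  rw [Finset.mem_range] at hj
  congr 2
  omega

lemma pqInt_zero : pqInt p q 0 = 0 := by simp [pqInt]

lemma pqInt_one : pqInt p q 1 = 1 := by simp [pqInt]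

lemma sum_fin_lt {M : Type*} [AddCommMonoid M] {n b : ℕ} (hb : b ≤ n) (f : ℕ → M) :
    (∑ i : Fin n, if (i : ℕ) < b then f i else 0) = ∑ i ∈ Finset.range b, f i := by
  rw [Fin.sum_univ_eq_sum_range (fun i => if i < b then f i else 0), ← Finset.sum_filter]
  refine Finset.sum_congr ?_ fun _ _ => rfl
  ext i
  simp
  omega

lemma highSum_lower (a n : ℕ) (ha : a ≤ n) :
    highSum p q t a a (n + 1) =
      highSum p q t (a + 1) a (n + 1) + pqInt p q a * highSum p q t a (a - 1) n := by
  let r : Fin (n + 1) := ⟨a, by omega⟩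
  let w : Equiv.Perm (Fin (n + 1)) → R := fun τ =>
    p ^ nestStat (n + 1) τ * q ^ crosStat (n + 1) τ * t ^ wexStat (n + 1) τ
  have key : ∀ τ : Equiv.Perm (Fin (n + 1)), (if HighRows a a τ then w τ else 0) =
      (if HighRows (a + 1) a τ then w τ else 0) +
      ∑ c : Fin (n + 1), if (c : ℕ) < a then
        (if τ r = c then (if HighRows a a τ then w τ else 0) else 0) else 0 := by
    intro τ
    have h1 : (∑ c : Fin (n + 1), if (c : ℕ) < a then
        (if τ r = c then (if HighRows a a τ then w τ else 0) else 0) else 0) =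
        if (τ r : ℕ) < a then (if HighRows a a τ then w τ else 0) else 0 := by
      rw [Finset.sum_eq_single (τ r)]
      · simp
      · intro c _ hc
        simp [hc.symm]
      · simp
    have h2 : HighRows (a + 1) a τ ↔ HighRows a a τ ∧ ¬ (τ r : ℕ) < a := by
      constructor
      · exact fun h => ⟨fun i hi => h i (by omega), by simpa using h r (by simp [r])⟩
      · rintro ⟨h, h'⟩ i hi
        rcases Nat.lt_succ_iff_lt_or_eq.1 hi with hi | hi
        · exact h i hi
        · obtain rfl : i = r := Fin.ext hi
          omega
    rw [h1]
    by_cases hh : HighRows a a τ <;> by_cases hl : (τ r : ℕ) < a <;>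
      simp only [h2, hh, hl, if_true, if_false, not_true, not_false_iff, and_true, and_false,
        add_zero, zero_add, ite_self]
  have e1 : highSum p q t a a (n + 1) = ∑ τ, if HighRows a a τ then w τ else 0 := rfl
  have e2 : highSum p q t (a + 1) a (n + 1) =
    ∑ τ, if HighRows (a + 1) a τ then w τ else 0 := rfl
  rw [e1, Finset.sum_congr rfl fun τ _ => key τ, Finset.sum_add_distrib, ← e2]
  congr 1
  rw [Finset.sum_comm, pqInt_eq_sum_range, Finset.sum_mul,
    ← sum_fin_lt (show a ≤ n + 1 by omega)
      (fun i => p ^ i * q ^ (a - 1 - i) * highSum p q t a (a - 1) n)]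
  refine Finset.sum_congr rfl fun c _ => ?_
  by_cases hc : (c : ℕ) < a
  · simp only [hc, if_true]
    rw [sum_perm_apply_eq, highSum, Finset.mul_sum]
    refine Finset.sum_congr rfl fun σ _ => ?_
    have hcr : c < r := hc
    have := highRows_insPerm_lower (σ := σ) hcr
    change HighRows a a (insPerm r c σ) ↔ HighRows a (a - 1) σ at this
    simp only [this]
    by_cases h : HighRows a (a - 1) σ
    · simp only [h, if_true, w, nestStat_insPerm_lower hcr h, crosStat_insPerm_lower hcr h,
        wexStat_insPerm_lower hcr h]
      simp only [r]
      ring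
    · simp [h]
  · simp [hc]

lemma highSum_upper (a n : ℕ) (ha : a ≤ n) :
    highSum p q t (a + 1) a (n + 1) =
      highSum p q t (a + 1) (a + 1) (n + 1) + t * pqInt p q (a + 1) * highSum p q t a a n := by
  let c : Fin (n + 1) := ⟨a, by omega⟩
  let w : Equiv.Perm (Fin (n + 1)) → R := fun τ =>
    p ^ nestStat (n + 1) τ * q ^ crosStat (n + 1) τ * t ^ wexStat (n + 1) τ
  have key : ∀ τ : Equiv.Perm (Fin (n + 1)), (if HighRows (a + 1) a τ then w τ else 0) =
      (if HighRows (a + 1) (a + 1) τ then w τ else 0) +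
      ∑ r : Fin (n + 1), if (r : ℕ) < a + 1 then
        (if τ r = c then (if HighRows (a + 1) a τ then w τ else 0) else 0) else 0 := by
    intro τ
    have h1 : (∑ r : Fin (n + 1), if (r : ℕ) < a + 1 then
        (if τ r = c then (if HighRows (a + 1) a τ then w τ else 0) else 0) else 0) =
        if (τ⁻¹ c : ℕ) < a + 1 then (if HighRows (a + 1) a τ then w τ else 0) else 0 := by
      rw [Finset.sum_eq_single (τ⁻¹ c)]
      · simp
      · intro r _ hr
        have : τ r ≠ c := fun h => hr (by simp [← h])
        simp [this]
      · simp
    have h2 : HighRows (a + 1) (a + 1) τ ↔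
        HighRows (a + 1) a τ ∧ ¬ (τ⁻¹ c : ℕ) < a + 1 := by
      constructor
      · refine fun h => ⟨fun i hi => (Nat.le_succ a).trans (h i hi), fun hlt => ?_⟩
        have := h _ hlt
        simp [c] at this
      · rintro ⟨h, h'⟩ i hi
        rcases (h i hi).lt_or_eq with hl | hl
        · exact hl
        · have : τ i = c := Fin.ext hl.symm
          rw [← this] at h'
          simp at h'
          omega
    rw [h1]
    by_cases hh : HighRows (a + 1) a τ <;> by_cases hl : (τ⁻¹ c : ℕ) < a + 1 <;>
      simp only [h2, hh, hl, if_true, if_false, not_true, not_false_iff, and_true, and_false,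
        add_zero, zero_add]
  have e1 : highSum p q t (a + 1) a (n + 1) =
    ∑ τ, if HighRows (a + 1) a τ then w τ else 0 := rfl
  have e2 : highSum p q t (a + 1) (a + 1) (n + 1) =
    ∑ τ, if HighRows (a + 1) (a + 1) τ then w τ else 0 := rfl
  rw [e1, Finset.sum_congr rfl fun τ _ => key τ, Finset.sum_add_distrib, ← e2]
  congr 1
  rw [Finset.sum_comm, pqInt_eq_sum_range, Finset.mul_sum, Finset.sum_mul,
    ← sum_fin_lt (show a + 1 ≤ n + 1 by omega)
      (fun i => t * (p ^ i * q ^ (a + 1 - 1 - i)) * highSum p q t a a n)]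
  refine Finset.sum_congr rfl fun r _ => ?_
  by_cases hr : (r : ℕ) < a + 1
  · simp only [hr, if_true]
    rw [sum_perm_apply_eq, highSum, Finset.mul_sum]
    refine Finset.sum_congr rfl fun σ _ => ?_
    have hrc : r ≤ c := Nat.lt_succ_iff.1 hr
    have := highRows_insPerm_upper (σ := σ) hrc
    change HighRows (a + 1) a (insPerm r c σ) ↔ HighRows a a σ at this
    simp only [this]
    by_cases h : HighRows a a σ
    · simp only [h, if_true, w, nestStat_insPerm_upper hrc h, crosStat_insPerm_upper hrc h,
        wexStat_insPerm_upper hrc h]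
      simp only [c, Nat.add_sub_cancel]
      ring
    · simp [h]
  · simp [hr]

lemma highSum_self (n : ℕ) : highSum p q t n n n = if n = 0 then 1 else 0 := by
  split_ifs with h
  · subst h
    simp [highSum, HighRows, nestStat, crosStat, wexStat, pairs]
  · refine Finset.sum_eq_zero fun σ _ => if_neg fun hσ => ?_
    have := hσ ⟨0, by omega⟩ (by simp; omega)
    omega

lemma highSum_zero (n : ℕ) : highSum p q t 0 0 n =
    ∑ σ : Equiv.Perm (Fin n), p ^ nestStat n σ * q ^ crosStat n σ * t ^ wexStat n σ := by
  simp [highSum, HighRows]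

/-- The generating function of the labelled paths from height `g` to height `0` with `m`
steps, in which a step from height `h` has weight `[h]_{p,q}`, multiplied by `1 + t` for a
level step and by `t` for an up step. -/
def pathSum : ℕ → ℕ → R
  | 0, 0 => 1
  | _ + 1, 0 => 0
  | 0, _ + 1 => 0
  | g + 1, m + 1 => pqInt p q (g + 1) *
      (pathSum g m + (1 + t) * pathSum (g + 1) m + t * pathSum (g + 2) m)

lemma pathSum_succ_succ (g m : ℕ) : pathSum p q t (g + 1) (m + 1) = pqInt p q (g + 1) *
    (pathSum p q t g m + (1 + t) * pathSum p q t (g + 1) m + t * pathSum p q t (g + 2) m) :=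
  rfl

lemma highSum_eq_pathSum (m a : ℕ) :
    highSum p q t (a + 1) a (a + m + 1) =
      t ^ (a + 1) * (∏ i ∈ Finset.range a, pqInt p q (i + 1)) * pathSum p q t (a + 1) (m + 1) := by
  induction m generalizing a with
  | zero =>
    rw [add_zero, highSum_upper p q t a a le_rfl, highSum_self, highSum_self]
    cases a with
    | zero => simp [pathSum, pqInt_one]
    | succ a => simp [pathSum]
  | succ m ih =>
    have h1 := highSum_upper p q t a (a + (m + 1)) (by omega)
    have h2 := highSum_lower p q t (a + 1) (a + (m + 1)) (by omega)
    have h3 := highSum_lower p q t a (a + m) (by omega)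
    have i1 := ih (a + 1)
    have i2 := ih a
    have e1 : a + 1 + m + 1 = a + (m + 1) + 1 := by omega
    have e2 : a + (m + 1) = a + m + 1 := by omega
    rw [e1] at i1
    rw [h1, h2, i1, e2, h3, Nat.add_sub_cancel, i2, pathSum_succ_succ p q t a (m + 1),
      Finset.prod_range_succ]
    cases a with
    | zero =>
      simp [pqInt_zero, pathSum, pqInt_one]
      ring
    | succ a =>
      have i3 := ih a
      have e3 : a + 1 + m = a + m + 1 := by omega
      rw [Nat.add_sub_cancel, e3, i3, Finset.prod_range_succ]
      ring

theorem sum_nest_cros_wex_eq_pathSum (n : ℕ) :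
    (∑ σ : Equiv.Perm (Fin (n + 1)),
        p ^ nestStat (n + 1) σ * q ^ crosStat (n + 1) σ * t ^ wexStat (n + 1) σ) =
      t * pathSum p q t 1 (n + 1) := by
  rw [← highSum_zero, highSum_lower p q t 0 n (Nat.zero_le n), pqInt_zero, zero_mul, add_zero]
  simpa using highSum_eq_pathSum p q t n 0

end CyclicRecursion

section Words

/-- The number of pairs of adjacent letters `a, b` of a word with `a < y < b`; the flag tells
whether the word is preceded by a letter smaller than `y`. -/
def ups (y : ℕ) : Bool → List ℕ → ℕ
  | _, [] => 0
  | low, b :: l => (low && decide (y < b)).toNat + ups y (decide (b < y)) l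

/-- The number of pairs of adjacent letters `a, b` of a word with `a > y > b`; the flag tells
whether the word is preceded by a letter larger than `y`. -/
def downs (y : ℕ) : Bool → List ℕ → ℕ
  | _, [] => 0
  | high, b :: l => (high && decide (b < y)).toNat + downs y (decide (y < b)) l

lemma ups_low_append {y : ℕ} {w : List ℕ} (hw : ∀ a ∈ w, a < y) (hne : w ≠ []) (low : Bool)
    (B : List ℕ) : ups y low (w ++ B) = ups y true B := by
  induction w generalizing low with
  | nil => exact absurd rfl hne
  | cons a w ih =>
    have ha : a < y := hw a (by simp)
    by_cases hw' : w = []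
    · simp [hw', ups, ha, ha.le]
    · simp [ups, ha, ha.le, ih (fun b hb => hw b (by simp [hb])) hw']

lemma downs_low_append {y : ℕ} {w : List ℕ} (hw : ∀ a ∈ w, a < y) (hne : w ≠ []) (high : Bool)
    (B : List ℕ) : downs y high (w ++ B) = high.toNat + downs y false B := by
  induction w generalizing high with
  | nil => exact absurd rfl hne
  | cons a w ih =>
    have ha : a < y := hw a (by simp)
    have ha' : ¬ y < a := by omega
    by_cases hw' : w = []
    · simp [hw', downs, ha, ha']
    · simp [downs, ha, ha', ih (fun b hb => hw b (by simp [hb])) hw']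

lemma ups_replace_low {y : ℕ} {w w' : List ℕ} (hw : ∀ a ∈ w, a < y) (hne : w ≠ [])
    (hw' : ∀ a ∈ w', a < y) (hne' : w' ≠ []) (low : Bool) (A B : List ℕ) :
    ups y low (A ++ (w ++ B)) = ups y low (A ++ (w' ++ B)) := by
  induction A generalizing low with
  | nil => simp only [List.nil_append, ups_low_append hw hne, ups_low_append hw' hne']
  | cons a A ih => simp only [List.cons_append, ups, ih]

lemma downs_replace_low {y : ℕ} {w w' : List ℕ} (hw : ∀ a ∈ w, a < y) (hne : w ≠ [])
    (hw' : ∀ a ∈ w', a < y) (hne' : w' ≠ []) (high : Bool) (A B : List ℕ) :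
    downs y high (A ++ (w ++ B)) = downs y high (A ++ (w' ++ B)) := by
  induction A generalizing high with
  | nil => simp only [List.nil_append, downs_low_append hw hne, downs_low_append hw' hne']
  | cons a A ih => simp only [List.cons_append, downs, ih]

variable {R : Type*} [CommRing R] (p q t : R)

/-- The weight of a letter `y` with neighbours `l` and `r`: `1 + t` for a double ascent, `1`
for a peak, `t` for a valley and `0` for a double descent. -/
def letterWt (l y r : ℕ) : R :=
  if l < y then (if y < r then 1 + t else 1) else (if y < r then t else 0)

/-- The weight of the letter `y` in the word `A y B`; the letters `0` are separators. -/
def posWt (A : List ℕ) (y : ℕ) (B : List ℕ) : R :=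
  if y = 0 then 1 else
    p ^ ups y false B * q ^ downs y false A *
      letterWt t (A.getLast?.getD 0) y (B.head?.getD 0)

/-- The product of the weights of the letters of the second word in the concatenation of the
two words. -/
def wordWt : List ℕ → List ℕ → R
  | _, [] => 1
  | A, y :: B => posWt p q t A y B * wordWt (A ++ [y]) B

variable {p q t}

lemma letterWt_congr {l l' y r r' : ℕ} (hl : l < y ↔ l' < y) (hr : y < r ↔ y < r') :
    letterWt t l y r = letterWt t l' y r' := by
  simp [letterWt, hl, hr]

lemma getLast_getD_lt {y : ℕ} {w : List ℕ} (hw : ∀ a ∈ w, a < y) (hne : w ≠ []) :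
    w.getLast?.getD 0 < y := by
  rw [List.getLast?_eq_some_getLast hne]
  exact hw _ (List.getLast_mem hne)

lemma head_getD_lt {y : ℕ} {w : List ℕ} (hw : ∀ a ∈ w, a < y) (hne : w ≠ []) :
    w.head?.getD 0 < y := by
  rw [List.head?_eq_some_head hne]
  exact hw _ (List.head_mem hne)

lemma posWt_replace_low_right {y : ℕ} {w w' : List ℕ} (hw : ∀ a ∈ w, y = 0 ∨ a < y)
    (hne : w ≠ []) (hw' : ∀ a ∈ w', y = 0 ∨ a < y) (hne' : w' ≠ []) (P A B : List ℕ) :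
    posWt p q t P y (A ++ (w ++ B)) = posWt p q t P y (A ++ (w' ++ B)) := by
  by_cases hy : y = 0
  · simp [posWt, hy]
  simp only [hy, false_or] at hw hw'
  rw [posWt, posWt, ups_replace_low hw hne hw' hne']
  congr 2
  refine letterWt_congr Iff.rfl ?_
  cases A with
  | nil =>
    have h1 := head_getD_lt hw hne
    have h2 := head_getD_lt hw' hne'
    obtain ⟨a, w, rfl⟩ := List.exists_cons_of_ne_nil hne
    obtain ⟨b, w', rfl⟩ := List.exists_cons_of_ne_nil hne'
    simp at *
    omega
  | cons a A => simp

lemma posWt_replace_low_left {y : ℕ} {w w' : List ℕ} (hw : ∀ a ∈ w, y = 0 ∨ a < y)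
    (hne : w ≠ []) (hw' : ∀ a ∈ w', y = 0 ∨ a < y) (hne' : w' ≠ []) (Q A B : List ℕ) :
    posWt p q t (Q ++ (w ++ A)) y B = posWt p q t (Q ++ (w' ++ A)) y B := by
  by_cases hy : y = 0
  · simp [posWt, hy]
  simp only [hy, false_or] at hw hw'
  rw [posWt, posWt, downs_replace_low hw hne hw' hne']
  congr 2
  refine letterWt_congr ?_ Iff.rfl
  rcases List.eq_nil_or_concat A with rfl | ⟨A, a, rfl⟩
  · have h1 := getLast_getD_lt hw hne
    have h2 := getLast_getD_lt hw' hne'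
    rw [List.getLast?_eq_some_getLast hne] at h1
    rw [List.getLast?_eq_some_getLast hne'] at h2
    simp [List.getLast?_append, List.getLast?_eq_some_getLast hne,
      List.getLast?_eq_some_getLast hne'] at *
    omega
  · simp [List.getLast?_append]

lemma wordWt_replace_low_left {w w' : List ℕ} (hne : w ≠ []) (hne' : w' ≠ []) (Q A B : List ℕ)
    (hw : ∀ y ∈ B, ∀ a ∈ w, y = 0 ∨ a < y) (hw' : ∀ y ∈ B, ∀ a ∈ w', y = 0 ∨ a < y) :
    wordWt p q t (Q ++ (w ++ A)) B = wordWt p q t (Q ++ (w' ++ A)) B := by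
  induction B generalizing A with
  | nil => rfl
  | cons y B ih =>
    simp only [wordWt]
    rw [posWt_replace_low_left (hw y (by simp)) hne (hw' y (by simp)) hne']
    have := ih (A ++ [y]) (fun z hz => hw z (by simp [hz])) (fun z hz => hw' z (by simp [hz]))
    simp only [List.append_assoc] at this ⊢
    rw [this]

lemma wordWt_append_congr {w w' : List ℕ} (hne : w ≠ []) (hne' : w' ≠ []) (K : R)
    (P A B : List ℕ) (hw : ∀ y ∈ A, ∀ a ∈ w, y = 0 ∨ a < y)
    (hw' : ∀ y ∈ A, ∀ a ∈ w', y = 0 ∨ a < y)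
    (h : wordWt p q t (P ++ A) (w ++ B) = K * wordWt p q t (P ++ A) (w' ++ B)) :
    wordWt p q t P (A ++ (w ++ B)) = K * wordWt p q t P (A ++ (w' ++ B)) := by
  induction A generalizing P with
  | nil => simpa using h
  | cons y A ih =>
    simp only [wordWt, List.cons_append]
    rw [posWt_replace_low_right (hw y (by simp)) hne (hw' y (by simp)) hne',
      ih (P ++ [y]) (fun z hz => hw z (by simp [hz])) (fun z hz => hw' z (by simp [hz]))
        (by simpa using h)]
    ring

lemma wordWt_zeros_append {w : List ℕ} (hw : ∀ a ∈ w, a = 0) (P B : List ℕ) :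
    wordWt p q t P (w ++ B) = wordWt p q t (P ++ w) B := by
  induction w generalizing P with
  | nil => simp
  | cons a w ih =>
    simp [wordWt, hw a (by simp), posWt, ih (fun b hb => hw b (by simp [hb]))]

/-- Replacing a separator by a new smallest letter, possibly keeping a separator on either side,
multiplies the weight of a word by the weight of the new letter. -/
lemma wordWt_insert {x : ℕ} {w₁ w₂ : List ℕ} (hw₁ : ∀ a ∈ w₁, a = 0) (hw₂ : ∀ a ∈ w₂, a = 0)
    (A B : List ℕ) (hA : ∀ y ∈ A, y = 0 ∨ x < y) (hB : ∀ y ∈ B, y = 0 ∨ x < y) :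
    wordWt p q t [] ((A ++ w₁) ++ x :: (w₂ ++ B)) =
      posWt p q t (A ++ w₁) x (w₂ ++ B) * wordWt p q t [] (A ++ 0 :: B) := by
  have hlow : ∀ y, (y = 0 ∨ x < y) → ∀ a ∈ w₁ ++ x :: w₂, y = 0 ∨ a < y := by
    intro y hy a ha
    simp only [List.mem_append, List.mem_cons] at ha
    rcases ha with ha | rfl | ha
    · have := hw₁ a ha
      omega
    · exact hy
    · have := hw₂ a ha
      omega
  have hzero : ∀ y : ℕ, (y = 0 ∨ x < y) → ∀ a ∈ [0], y = 0 ∨ a < y := by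
    intro y hy a ha
    simp at ha
    omega
  have := wordWt_append_congr (p := p) (q := q) (t := t) (w := w₁ ++ x :: w₂) (w' := [0])
    (by simp) (by simp) (posWt p q t (A ++ w₁) x (w₂ ++ B)) [] A B
    (fun y hy => hlow y (hA y hy)) (fun y hy => hzero y (hA y hy)) ?_
  · simpa using this
  · rw [List.append_assoc, wordWt_zeros_append hw₁]
    simp only [List.cons_append, List.nil_append, wordWt]
    rw [wordWt_zeros_append hw₂]
    have h := wordWt_replace_low_left (p := p) (q := q) (t := t) (w := w₁ ++ x :: w₂) (w' := [0])
      (by simp) (by simp) A [] B (fun y hy => hlow y (hB y hy)) (fun y hy => hzero y (hB y hy))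
    simp only [List.append_assoc, List.append_nil, List.cons_append, List.nil_append] at h ⊢
    rw [h]
    simp [posWt]

lemma ups_add_one {x : ℕ} (hx : 0 < x) (B : List ℕ) (low : Bool)
    (hc : B.IsChain fun a b => a ≠ 0 ∨ b ≠ 0) (hl : B.getLast? = some 0)
    (hlow : low = true → B.head? ≠ some 0) (hB : ∀ b ∈ B, b = 0 ∨ x < b) :
    ups x low B + 1 = B.count 0 + low.toNat := by
  induction B generalizing low with
  | nil => simp at hl
  | cons b B ih =>
    rw [List.isChain_cons] at hc
    rcases hB b (by simp) with rfl | hb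
    · have : low = false := by simpa using hlow
      subst this
      by_cases hne : B = []
      · simp [hne, ups]
      · have := ih true hc.2 (by rwa [← List.getLast?_cons_of_ne_nil hne])
          (fun _ h => by simpa using hc.1 0 h) (fun c hcB => hB c (by simp [hcB]))
        simp [ups, hx] at this ⊢
        omega
    · have hb0 : b ≠ 0 := by omega
      have hne : B ≠ [] := by
        rintro rfl
        simp at hl
        omega
      have := ih false hc.2 (by rwa [← List.getLast?_cons_of_ne_nil hne])
        (by simp) (fun c hcB => hB c (by simp [hcB]))
      have h1 : ¬ b < x := by omega
      simp [ups, h1, hb, hb0] at this ⊢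
      omega

lemma downs_add_ite {x : ℕ} (hx : 0 < x) (A : List ℕ) (high : Bool)
    (hc : A.IsChain fun a b => a ≠ 0 ∨ b ≠ 0) (hA : ∀ a ∈ A, a = 0 ∨ x < a) :
    downs x high A + (if A.head? = some 0 ∧ high = false then 1 else 0) = A.count 0 := by
  induction A generalizing high with
  | nil => simp [downs]
  | cons a A ih =>
    rw [List.isChain_cons] at hc
    rcases hA a (by simp) with rfl | ha
    · have := ih false hc.2 (fun c hcA => hA c (by simp [hcA]))
      have h0 : A.head? ≠ some 0 := fun h => by simpa using hc.1 0 h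
      cases high <;> simp [downs, hx, h0] at this ⊢ <;> omega
    · have := ih true hc.2 (fun c hcA => hA c (by simp [hcA]))
      have ha0 : a ≠ 0 := by omega
      have h1 : ¬ a < x := by omega
      simp [downs, h1, ha, ha0] at this ⊢
      omega

end Words

section Splits

/-- The pairs `(A, B)` of words with `A v B` equal to the given word. -/
def splits (v : ℕ) : List ℕ → Finset (List ℕ × List ℕ)
  | [] => ∅
  | a :: l => (if a = v then {([], l)} else ∅) ∪ (splits v l).image fun x => (a :: x.1, x.2)

lemma mem_splits {v : ℕ} {L : List ℕ} {x : List ℕ × List ℕ} :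
    x ∈ splits v L ↔ x.1 ++ v :: x.2 = L := by
  induction L generalizing x with
  | nil => simp [splits]
  | cons a l ih =>
    obtain ⟨A, B⟩ := x
    cases A with
    | nil =>
      simp [splits]
      split_ifs <;> simp_all [eq_comm]
    | cons b A =>
      simp [splits, ih]
      split_ifs <;> simp [and_comm, eq_comm]

lemma sum_splits {M : Type*} [AddCommMonoid M] (v : ℕ) (L : List ℕ) (u : ℕ → M) :
    ∑ x ∈ splits v L, u (x.1.count v) = ∑ r ∈ Finset.range (L.count v), u r := by
  induction L generalizing u with
  | nil => simp [splits]
  | cons a l ih =>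
    rw [splits, Finset.sum_union, Finset.sum_image]
    · by_cases h : a = v
      · subst h
        simp [ih (fun r => u (r + 1)), Finset.sum_range_succ', add_comm]
      · simp [h, ih u]
    · rintro ⟨A, B⟩ _ ⟨A', B'⟩ _ h
      simpa using h
    · rw [Finset.disjoint_left]
      intro x hx hx'
      split_ifs at hx
      · simp at hx hx'
        obtain ⟨A, B, _, rfl⟩ := hx'
        simp at hx
      · simp at hx

/-- The pairs `(A, B)` of words with `A v B` in the given set. -/
def splitsOf (v : ℕ) (S : Finset (List ℕ)) : Finset (List ℕ × List ℕ) := S.biUnion (splits v)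

lemma mem_splitsOf {v : ℕ} {S : Finset (List ℕ)} {x : List ℕ × List ℕ} :
    x ∈ splitsOf v S ↔ x.1 ++ v :: x.2 ∈ S := by
  simp [splitsOf, mem_splits]

lemma sum_splitsOf {R : Type*} [CommRing R] (v : ℕ) (S : Finset (List ℕ)) (G : List ℕ → R)
    (u : ℕ → R) :
    ∑ x ∈ splitsOf v S, u (x.1.count v) * G (x.1 ++ v :: x.2) =
      ∑ L ∈ S, (∑ r ∈ Finset.range (L.count v), u r) * G L := by
  rw [splitsOf, Finset.sum_biUnion]
  · refine Finset.sum_congr rfl fun L _ => ?_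
    rw [← sum_splits, Finset.sum_mul]
    exact Finset.sum_congr rfl fun x hx => by rw [mem_splits.1 hx]
  · intro L _ L' _ hne
    refine Finset.disjoint_left.2 fun x hx hx' => hne ?_
    rw [← mem_splits.1 hx, ← mem_splits.1 hx']

end Splits

section Configurations

/-- `L` is a word `0 w₁ 0 w₂ 0 ⋯ 0 w_g 0` with nonempty `w₁, …, w_g` whose letters are
`s + 1, …, n`, each of them occurring once. -/
def IsConf (n g s : ℕ) (L : List ℕ) : Prop :=
  (∀ y, L.count y = if y = 0 then g + 1 else if s < y ∧ y ≤ n then 1 else 0) ∧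
    (L.IsChain fun a b => a ≠ 0 ∨ b ≠ 0) ∧ L.head? = some 0 ∧ L.getLast? = some 0

/-- The finite set of the words satisfying `IsConf`. -/
def confs (n g s : ℕ) : Finset (List ℕ) :=
  (Multiset.lists (Multiset.replicate (g + 1) 0 + (Finset.Ioc s n).val)).toFinset.filter
    (IsConf n g s)

lemma mem_confs {n g s : ℕ} {L : List ℕ} : L ∈ confs n g s ↔ IsConf n g s L := by
  simp only [confs, Finset.mem_filter, Multiset.mem_toFinset, Multiset.mem_lists_iff,
    and_iff_right_iff_imp]
  intro h
  ext y
  rw [Multiset.quot_mk_to_coe, Multiset.coe_count, h.1 y, Multiset.count_add,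
    Multiset.count_replicate, Multiset.count_eq_of_nodup (Finset.nodup _)]
  by_cases hy : y = 0
  · simp [hy]
  · simp [hy, Ne.symm hy]

variable {n g s : ℕ} {A B L : List ℕ}

lemma IsConf.mem_eq_zero_or (h : IsConf n g s L) {y : ℕ} (hy : y ∈ L) : y = 0 ∨ s < y := by
  have := List.count_pos_iff.2 hy
  rw [h.1 y] at this
  split_ifs at this <;> omega

lemma isConf_peak (hs : s < n) :
    IsConf n (g + 1) s ((A ++ [0]) ++ (s + 1) :: 0 :: B) ↔ IsConf n g (s + 1) (A ++ 0 :: B) := by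
  have hcount : (∀ y, ((A ++ [0]) ++ (s + 1) :: 0 :: B).count y =
      if y = 0 then g + 1 + 1 else if s < y ∧ y ≤ n then 1 else 0) ↔
      ∀ y, (A ++ 0 :: B).count y =
        if y = 0 then g + 1 else if s + 1 < y ∧ y ≤ n then 1 else 0 := by
    refine forall_congr' fun y => ?_
    simp only [List.count_append, List.count_cons, List.count_nil, beq_iff_eq]
    split_ifs <;> omega
  unfold IsConf
  rw [hcount]
  refine and_congr_right fun _ => and_congr ?_ (and_congr ?_ ?_)
  · simp [List.isChain_append, List.isChain_cons]
  · cases A <;> simp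
  · simp [List.getLast?_append, List.getLast?_cons]

lemma isConf_doubleAscent (hs : s < n) :
    (IsConf n (g + 1) s ((A ++ [0]) ++ (s + 1) :: B) ∧ B.head? ≠ some 0) ↔
      (IsConf n (g + 1) (s + 1) (A ++ 0 :: B) ∧ B ≠ []) := by
  have hcount : (∀ y, ((A ++ [0]) ++ (s + 1) :: B).count y =
      if y = 0 then g + 1 + 1 else if s < y ∧ y ≤ n then 1 else 0) ↔
      ∀ y, (A ++ 0 :: B).count y =
        if y = 0 then g + 1 + 1 else if s + 1 < y ∧ y ≤ n then 1 else 0 := by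
    refine forall_congr' fun y => ?_
    simp only [List.count_append, List.count_cons, List.count_nil, beq_iff_eq]
    split_ifs <;> omega
  unfold IsConf
  rw [hcount]
  rcases B with _ | ⟨b, B⟩
  · simp [List.getLast?_append, List.getLast?_cons]
  · cases A <;> simp [List.isChain_append, List.isChain_cons] <;> grind

lemma isConf_valley (hs : s < n) :
    (IsConf n g s (A ++ (s + 1) :: B) ∧ A.getLast? ≠ some 0 ∧ B.head? ≠ some 0) ↔
      (IsConf n (g + 1) (s + 1) (A ++ 0 :: B) ∧ A ≠ [] ∧ B ≠ []) := by
  have hcount : (∀ y, (A ++ (s + 1) :: B).count y =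
      if y = 0 then g + 1 else if s < y ∧ y ≤ n then 1 else 0) ↔
      ∀ y, (A ++ 0 :: B).count y =
        if y = 0 then g + 1 + 1 else if s + 1 < y ∧ y ≤ n then 1 else 0 := by
    refine forall_congr' fun y => ?_
    simp only [List.count_append, List.count_cons, beq_iff_eq]
    split_ifs <;> omega
  unfold IsConf
  rw [hcount]
  rcases B with _ | ⟨b, B⟩
  · simp [List.getLast?_append, List.getLast?_cons]
  clear hcount
  rcases List.eq_nil_or_concat A with rfl | ⟨A, a, rfl⟩
  · simp
  · cases A <;>
      simp [List.isChain_append, List.isChain_cons, List.getLast?_append, List.getLast?_cons] <;>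
      tauto

lemma IsConf.eq_nil_or_getLast (h : IsConf n g s (A ++ 0 :: B)) :
    B = [] ∨ B.getLast? = some 0 := by
  rcases B with _ | ⟨b, B⟩
  · simp
  · right
    simpa [List.getLast?_append] using h.2.2.2

lemma IsConf.eq_nil_iff (h : IsConf n g s (A ++ 0 :: B)) : B = [] ↔ A.count 0 = g := by
  have hc := h.1 0
  simp at hc
  have : B = [] ↔ B.count 0 = 0 := by
    rcases h.eq_nil_or_getLast with rfl | hl
    · simp
    · have : 0 ∈ B := List.mem_of_getLast? hl
      rw [List.count_eq_zero]
      refine ⟨fun hB => by simp [hB], fun hB => absurd this hB⟩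
  rw [this]
  omega

lemma IsConf.eq_nil_iff_left (h : IsConf n g s (A ++ 0 :: B)) : A = [] ↔ A.count 0 = 0 := by
  constructor
  · rintro rfl
    simp
  · intro hA
    rcases A with _ | ⟨a, A⟩
    · rfl
    · have := h.2.2.1
      simp at this
      simp [this] at hA

variable {R : Type*} [CommRing R] {p q t : R}

lemma IsConf.posWt_peak (h : IsConf n g (s + 1) (A ++ 0 :: B)) :
    posWt p q t (A ++ [0]) (s + 1) (0 :: B) = p ^ (g - A.count 0) * q ^ A.count 0 := by
  have hc := h.1 0
  simp at hc
  have hch := h.2.1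
  have hup := ups_add_one (x := s + 1) (by omega) (0 :: B) false hch.right_of_append
    (by rcases h.eq_nil_or_getLast with rfl | hl <;> simp [List.getLast?_cons, *]) (by simp)
    (fun b hb => h.mem_eq_zero_or (by simp at hb ⊢; tauto))
  have hch' : (A ++ [0]).IsChain fun a b => a ≠ 0 ∨ b ≠ 0 := by
    rw [List.append_cons] at hch
    exact hch.left_of_append
  have hdown := downs_add_ite (x := s + 1) (by omega) (A ++ [0]) false hch'
    (fun b hb => h.mem_eq_zero_or (by simp at hb ⊢; tauto))
  have hd : (A ++ [0]).head? = some 0 := by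
    have := h.2.2.1
    cases A <;> simp_all
  simp [hd] at hdown hup
  have e1 : ups (s + 1) false (0 :: B) = g - A.count 0 := by omega
  simp [posWt, letterWt, e1, hdown]

lemma IsConf.posWt_doubleAscent (h : IsConf n (g + 1) (s + 1) (A ++ 0 :: B)) (hB : B ≠ []) :
    posWt p q t (A ++ [0]) (s + 1) B = p ^ (g - A.count 0) * q ^ A.count 0 * (1 + t) := by
  have hc := h.1 0
  simp at hc
  have hch := h.2.1
  have hch2 := List.isChain_cons.1 hch.right_of_append
  have hup := ups_add_one (x := s + 1) (by omega) B false hch2.2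
    (h.eq_nil_or_getLast.resolve_left hB) (by simp)
    (fun b hb => h.mem_eq_zero_or (by simp at hb ⊢; tauto))
  have hch' : (A ++ [0]).IsChain fun a b => a ≠ 0 ∨ b ≠ 0 := by
    rw [List.append_cons] at hch
    exact hch.left_of_append
  have hdown := downs_add_ite (x := s + 1) (by omega) (A ++ [0]) false hch'
    (fun b hb => h.mem_eq_zero_or (by simp at hb ⊢; tauto))
  have hd : (A ++ [0]).head? = some 0 := by
    have := h.2.2.1
    cases A <;> simp_all
  simp [hd] at hdown hup
  have e1 : ups (s + 1) false B = g - A.count 0 := by omega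
  have hhead : s + 1 < B.head?.getD 0 := by
    rcases B with _ | ⟨b, B⟩
    · exact absurd rfl hB
    · have := h.mem_eq_zero_or (y := b) (by simp)
      have := hch2.1 b (by simp)
      simp at this ⊢
      omega
  simp [posWt, letterWt, e1, hdown, hhead]

lemma IsConf.last_lt (h : IsConf n g s (A ++ 0 :: B)) (hA : A ≠ []) :
    s < A.getLast?.getD 0 := by
  have hch := (List.isChain_append.1 h.2.1).2.2
  rcases List.eq_nil_or_concat A with rfl | ⟨A, a, rfl⟩
  · exact absurd rfl hA
  · have := h.mem_eq_zero_or (y := a) (by simp)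
    have := hch a (by simp) 0 (by simp)
    simp at this ⊢
    omega

lemma IsConf.posWt_valley (h : IsConf n (g + 2) (s + 1) (A ++ 0 :: B)) (hA : A ≠ [])
    (hB : B ≠ []) :
    posWt p q t A (s + 1) B = p ^ (g + 1 - A.count 0) * q ^ (A.count 0 - 1) * t := by
  have hc := h.1 0
  simp at hc
  have hch := h.2.1
  have hch2 := List.isChain_cons.1 hch.right_of_append
  have hup := ups_add_one (x := s + 1) (by omega) B false hch2.2
    (h.eq_nil_or_getLast.resolve_left hB) (by simp)
    (fun b hb => h.mem_eq_zero_or (by simp at hb ⊢; tauto))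
  have hdown := downs_add_ite (x := s + 1) (by omega) A false hch.left_of_append
    (fun b hb => h.mem_eq_zero_or (by simp at hb ⊢; tauto))
  have hd : A.head? = some 0 := by
    have := h.2.2.1
    cases A
    · exact absurd rfl hA
    · simpa using this
  simp [hd] at hdown hup
  have e1 : ups (s + 1) false B = g + 1 - A.count 0 := by omega
  have e2 : downs (s + 1) false A = A.count 0 - 1 := by omega
  have hlast := h.last_lt hA
  have hhead : s + 1 < B.head?.getD 0 := by
    rcases B with _ | ⟨b, B⟩
    · exact absurd rfl hB
    · have := h.mem_eq_zero_or (y := b) (by simp)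
      have := hch2.1 b (by simp)
      simp at this ⊢
      omega
  have hlast' : ¬ A.getLast?.getD 0 < s + 1 := by omega
  simp [posWt, letterWt, e1, e2, hhead, hlast']

end Configurations

section ConfSum

variable {R : Type*} [CommRing R] (p q t : R)

/-- The total weight of the words satisfying `IsConf n g s`. -/
def confSum (n g s : ℕ) : R := ∑ L ∈ confs n g s, wordWt p q t [] L

variable {p q t}
variable {n g s : ℕ} {A B : List ℕ}

lemma IsConf.left_eq_zero_or (h : IsConf n g s (A ++ 0 :: B)) : ∀ y ∈ A, y = 0 ∨ s < y :=
  fun _ hy => h.mem_eq_zero_or (by simp [hy])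

lemma IsConf.right_eq_zero_or (h : IsConf n g s (A ++ 0 :: B)) : ∀ y ∈ B, y = 0 ∨ s < y :=
  fun _ hy => h.mem_eq_zero_or (by simp [hy])

lemma sum_splitsOf_confs (u : ℕ → R) :
    ∑ x ∈ splitsOf 0 (confs n g s), u (x.1.count 0) * wordWt p q t [] (x.1 ++ 0 :: x.2) =
      (∑ r ∈ Finset.range (g + 1), u r) * confSum p q t n g s := by
  rw [sum_splitsOf, confSum, Finset.mul_sum]
  refine Finset.sum_congr rfl fun L hL => ?_
  rw [(mem_confs.1 hL).1 0, if_pos rfl]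

lemma sum_peak (hs : s < n) :
    ∑ x ∈ splitsOf (s + 1) (confs n (g + 1) s) with x.1.getLast? = some 0 ∧ x.2.head? = some 0,
      wordWt p q t [] (x.1 ++ (s + 1) :: x.2) =
    pqInt p q (g + 1) * confSum p q t n g (s + 1) := by
  have := sum_splitsOf_confs (p := p) (q := q) (t := t) (n := n) (g := g) (s := s + 1)
    (fun r => p ^ (g - r) * q ^ r)
  rw [pqInt, Nat.add_sub_cancel, ← this]
  symm
  refine Finset.sum_bij (fun x _ => (x.1 ++ [0], 0 :: x.2)) ?_ ?_ ?_ ?_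
  · intro x hx
    rw [mem_splitsOf, mem_confs] at hx
    rw [Finset.mem_filter, mem_splitsOf, mem_confs]
    exact ⟨(isConf_peak hs).2 hx, by simp⟩
  · rintro ⟨A, B⟩ _ ⟨A', B'⟩ _ h
    simpa using h
  · rintro ⟨A, B⟩ hx
    rw [Finset.mem_filter, mem_splitsOf, mem_confs] at hx
    obtain ⟨hx, hA, hB⟩ := hx
    obtain ⟨A, rfl⟩ := List.getLast?_eq_some_iff.1 hA
    obtain ⟨B, rfl⟩ := List.head?_eq_some_iff.1 hB
    exact ⟨(A, B), by rw [mem_splitsOf, mem_confs]; exact (isConf_peak hs).1 hx, rfl⟩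
  · rintro ⟨A, B⟩ hx
    rw [mem_splitsOf, mem_confs] at hx
    have := wordWt_insert (p := p) (q := q) (t := t) (x := s + 1) (w₁ := [0]) (w₂ := [0])
      (by simp) (by simp) A B hx.left_eq_zero_or hx.right_eq_zero_or
    simp only [List.cons_append, List.nil_append, hx.posWt_peak] at this ⊢
    rw [this]

lemma sum_doubleAscent (hs : s < n) :
    ∑ x ∈ splitsOf (s + 1) (confs n (g + 1) s) with x.1.getLast? = some 0 ∧ x.2.head? ≠ some 0,
      wordWt p q t [] (x.1 ++ (s + 1) :: x.2) =
    pqInt p q (g + 1) * ((1 + t) * confSum p q t n (g + 1) (s + 1)) := by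
  have := sum_splitsOf_confs (p := p) (q := q) (t := t) (n := n) (g := g + 1) (s := s + 1)
    (fun r => if r = g + 1 then 0 else p ^ (g - r) * q ^ r * (1 + t))
  have hsum : ∑ r ∈ Finset.range (g + 1 + 1),
      (if r = g + 1 then 0 else p ^ (g - r) * q ^ r * (1 + t)) = pqInt p q (g + 1) * (1 + t) := by
    rw [Finset.sum_range_succ, if_pos rfl, add_zero, pqInt, Nat.add_sub_cancel, Finset.sum_mul]
    refine Finset.sum_congr rfl fun r hr => if_neg ?_
    simp at hr
    omega
  rw [← mul_assoc, ← hsum, ← this, eq_comm,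
    ← Finset.sum_filter_of_ne (p := fun x : List ℕ × List ℕ => x.2 ≠ [])]
  · refine Finset.sum_bij (fun x _ => (x.1 ++ [0], x.2)) ?_ ?_ ?_ ?_
    · intro x hx
      rw [Finset.mem_filter, mem_splitsOf, mem_confs] at hx
      rw [Finset.mem_filter, mem_splitsOf, mem_confs]
      have := (isConf_doubleAscent hs).2 hx
      exact ⟨this.1, by simp, this.2⟩
    · rintro ⟨A, B⟩ _ ⟨A', B'⟩ _ h
      simpa using h
    · rintro ⟨A, B⟩ hx
      rw [Finset.mem_filter, mem_splitsOf, mem_confs] at hx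
      obtain ⟨hx, hA, hB⟩ := hx
      obtain ⟨A, rfl⟩ := List.getLast?_eq_some_iff.1 hA
      refine ⟨(A, B), ?_, rfl⟩
      rw [Finset.mem_filter, mem_splitsOf, mem_confs]
      exact (isConf_doubleAscent hs).1 ⟨hx, hB⟩
    · rintro ⟨A, B⟩ hx
      rw [Finset.mem_filter, mem_splitsOf, mem_confs] at hx
      obtain ⟨hx, hB⟩ := hx
      have := wordWt_insert (p := p) (q := q) (t := t) (x := s + 1) (w₁ := [0]) (w₂ := [])
        (by simp) (by simp) A B hx.left_eq_zero_or hx.right_eq_zero_or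
      have hr : A.count 0 ≠ g + 1 := fun h => hB (hx.eq_nil_iff.2 h)
      simp only [List.nil_append, hx.posWt_doubleAscent hB] at this ⊢
      rw [this, if_neg hr]
  · rintro ⟨A, B⟩ hx hne hB
    rw [mem_splitsOf, mem_confs] at hx
    exact hne (by simp [hx.eq_nil_iff.1 hB])

lemma sum_valley (hs : s < n) :
    ∑ x ∈ splitsOf (s + 1) (confs n (g + 1) s) with x.1.getLast? ≠ some 0 ∧ x.2.head? ≠ some 0,
      wordWt p q t [] (x.1 ++ (s + 1) :: x.2) =
    pqInt p q (g + 1) * (t * confSum p q t n (g + 2) (s + 1)) := by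
  have := sum_splitsOf_confs (p := p) (q := q) (t := t) (n := n) (g := g + 2) (s := s + 1)
    (fun r => if r = 0 ∨ r = g + 2 then 0 else p ^ (g + 1 - r) * q ^ (r - 1) * t)
  have hsum : ∑ r ∈ Finset.range (g + 2 + 1),
      (if r = 0 ∨ r = g + 2 then 0 else p ^ (g + 1 - r) * q ^ (r - 1) * t) =
        pqInt p q (g + 1) * t := by
    rw [Finset.sum_range_succ, if_pos (Or.inr rfl), add_zero, Finset.sum_range_succ',
      if_pos (Or.inl rfl), add_zero, pqInt, Nat.add_sub_cancel, Finset.sum_mul]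
    refine Finset.sum_congr rfl fun r hr => ?_
    simp at hr
    rw [if_neg (by omega), Nat.add_sub_add_right, Nat.add_sub_cancel]
  rw [← mul_assoc, ← hsum, ← this, eq_comm,
    ← Finset.sum_filter_of_ne (p := fun x : List ℕ × List ℕ => x.1 ≠ [] ∧ x.2 ≠ [])]
  · refine Finset.sum_bij (fun x _ => x) ?_ ?_ ?_ ?_
    · intro x hx
      rw [Finset.mem_filter, mem_splitsOf, mem_confs] at hx
      rw [Finset.mem_filter, mem_splitsOf, mem_confs]
      exact (isConf_valley hs).2 hx
    · intro x _ y _ h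
      exact h
    · intro x hx
      rw [Finset.mem_filter, mem_splitsOf, mem_confs] at hx
      refine ⟨x, ?_, rfl⟩
      rw [Finset.mem_filter, mem_splitsOf, mem_confs]
      exact (isConf_valley hs).1 hx
    · rintro ⟨A, B⟩ hx
      rw [Finset.mem_filter, mem_splitsOf, mem_confs] at hx
      obtain ⟨hx, hA, hB⟩ := hx
      have := wordWt_insert (p := p) (q := q) (t := t) (x := s + 1) (w₁ := []) (w₂ := [])
        (by simp) (by simp) A B hx.left_eq_zero_or hx.right_eq_zero_or
      have hr : ¬ (A.count 0 = 0 ∨ A.count 0 = g + 2) := by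
        rw [← hx.eq_nil_iff_left, ← hx.eq_nil_iff]
        tauto
      simp only [List.nil_append, List.append_nil, hx.posWt_valley hA hB] at this ⊢
      rw [this, if_neg hr]
  · rintro ⟨A, B⟩ hx hne
    rw [mem_splitsOf, mem_confs] at hx
    refine ⟨fun hA => hne ?_, fun hB => hne ?_⟩
    · rw [if_pos (Or.inl (hx.eq_nil_iff_left.1 hA)), zero_mul]
    · rw [if_pos (Or.inr (hx.eq_nil_iff.1 hB)), zero_mul]

lemma sum_doubleDescent :
    ∑ x ∈ splitsOf (s + 1) (confs n (g + 1) s) with x.1.getLast? ≠ some 0 ∧ x.2.head? = some 0,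
      wordWt p q t [] (x.1 ++ (s + 1) :: x.2) = 0 := by
  refine Finset.sum_eq_zero ?_
  rintro ⟨A, B⟩ hx
  rw [Finset.mem_filter, mem_splitsOf, mem_confs] at hx
  obtain ⟨hx, hA, hB⟩ := hx
  simp only at hx hA hB ⊢
  have hlt : ∀ y ∈ A ++ B, y = 0 ∨ s + 1 < y := by
    intro y hy
    rcases hx.mem_eq_zero_or (y := y) (by simp at hy ⊢; tauto) with h | h
    · exact Or.inl h
    · refine Or.inr (lt_of_le_of_ne h ?_)
      rintro rfl
      have := hx.1 (s + 1)
      have hpos : 0 < (A ++ B).count (s + 1) := List.count_pos_iff.2 hy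
      simp only [List.count_append, List.count_cons_self] at this hpos
      split_ifs at this <;> omega
  have := wordWt_insert (p := p) (q := q) (t := t) (x := s + 1) (w₁ := []) (w₂ := [])
    (by simp) (by simp) A B (fun y hy => hlt y (by simp [hy])) (fun y hy => hlt y (by simp [hy]))
  simp only [List.nil_append, List.append_nil] at this
  rw [this]
  obtain ⟨B, rfl⟩ := List.head?_eq_some_iff.1 hB
  rcases List.eq_nil_or_concat A with rfl | ⟨A, a, rfl⟩
  · simpa using hx.2.2.1
  · have h1 := hlt a (by simp)
    simp at hA
    have h2 : ¬ a < s + 1 := by omega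
    simp [posWt, letterWt, h2]

lemma sum_eq_sum_filter_four {α : Type*} (S : Finset α) (f : α → R) (P Q : α → Prop) :
    ∑ x ∈ S, f x = ∑ x ∈ S with P x ∧ Q x, f x + ∑ x ∈ S with P x ∧ ¬ Q x, f x +
      ∑ x ∈ S with ¬ P x ∧ ¬ Q x, f x + ∑ x ∈ S with ¬ P x ∧ Q x, f x := by
  rw [← Finset.sum_filter_add_sum_filter_not S P,
    ← Finset.sum_filter_add_sum_filter_not (S.filter P) Q,
    ← Finset.sum_filter_add_sum_filter_not (S.filter fun x => ¬ P x) Q]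
  simp only [Finset.filter_filter]
  ring

lemma confSum_succ (hs : s < n) :
    confSum p q t n (g + 1) s = pqInt p q (g + 1) *
      (confSum p q t n g (s + 1) + (1 + t) * confSum p q t n (g + 1) (s + 1) +
        t * confSum p q t n (g + 2) (s + 1)) := by
  have h := sum_splitsOf (s + 1) (confs n (g + 1) s) (wordWt p q t []) (fun _ => 1)
  have h' : ∑ L ∈ confs n (g + 1) s,
      (∑ r ∈ Finset.range (L.count (s + 1)), (1 : R)) * wordWt p q t [] L =
        confSum p q t n (g + 1) s := by
    refine Finset.sum_congr rfl fun L hL => ?_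
    rw [(mem_confs.1 hL).1 (s + 1), if_neg (by omega), if_pos (by omega)]
    simp
  rw [← h', ← h, mul_add, mul_add, ← sum_peak hs, ← sum_doubleAscent hs, ← sum_valley hs]
  simp only [one_mul]
  refine (sum_eq_sum_filter_four _ _ (fun x => x.1.getLast? = some 0)
    (fun x => x.2.head? = some 0)).trans ((congrArg₂ (· + ·) ?_ ?_).trans (add_zero _))
  · congr!
  · convert sum_doubleDescent (p := p) (q := q) (t := t) (n := n) (g := g) (s := s)

lemma isConf_eq_singleton {L : List ℕ} (h : IsConf n g s L) (hgs : g = 0 ∨ n ≤ s) : L = [0] := by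
  obtain ⟨L, rfl⟩ := List.head?_eq_some_iff.1 h.2.2.1
  rcases hgs with rfl | hs
  · rcases List.eq_nil_or_concat L with rfl | ⟨L, a, rfl⟩
    · rfl
    · have h1 := h.1 0
      have h2 := h.2.2.2
      simp [List.getLast?_cons] at h1 h2
      simp [h2] at h1
  · rcases L with _ | ⟨b, L⟩
    · rfl
    · have h1 := h.1 b
      have h2 := h.2.1
      have hb : b ≠ 0 := by simpa using (List.isChain_cons.1 h2).1 b (by simp)
      rw [List.count_cons, List.count_cons_self, if_neg (by simpa using hb.symm), if_neg hb,
        if_neg (by omega)] at h1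
      omega

lemma confSum_zero_of_lt (hs : s < n) : confSum p q t n 0 s = 0 := by
  refine Finset.sum_eq_zero fun L hL => ?_
  rw [mem_confs] at hL
  have h := hL.1 (s + 1)
  rw [isConf_eq_singleton hL (Or.inl rfl), if_neg (by omega), if_pos (by omega)] at h
  simp at h

lemma confSum_succ_self : confSum p q t n (g + 1) n = 0 := by
  refine Finset.sum_eq_zero fun L hL => ?_
  rw [mem_confs] at hL
  have h := hL.1 0
  rw [isConf_eq_singleton hL (Or.inr le_rfl)] at h
  simp at h

lemma confSum_zero_self : confSum p q t n 0 n = 1 := by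
  have : confs n 0 n = {[0]} := by
    ext L
    rw [mem_confs, Finset.mem_singleton]
    refine ⟨fun h => isConf_eq_singleton h (Or.inl rfl), ?_⟩
    rintro rfl
    refine ⟨fun y => ?_, by simp⟩
    by_cases hy : y = 0
    · simp [hy]
    · simp [hy, Ne.symm hy]
  simp [confSum, this, wordWt, posWt]

lemma confSum_eq_pathSum (m : ℕ) : ∀ g s, s + m = n → confSum p q t n g s = pathSum p q t g m := by
  induction m with
  | zero =>
    rintro g s rfl
    cases g with
    | zero => simp [confSum_zero_self, pathSum]
    | succ g => simp [confSum_succ_self, pathSum]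
  | succ m ih =>
    intro g s h
    cases g with
    | zero => rw [confSum_zero_of_lt (by omega), pathSum]
    | succ g =>
      rw [confSum_succ (by omega), pathSum_succ_succ, ih _ _ (by omega), ih _ _ (by omega),
        ih _ _ (by omega)]

end ConfSum

section PermWord

variable {n : ℕ}

lemma pext_of_mem (σ : Equiv.Perm (Fin n)) {i : ℕ} (h : 1 ≤ i ∧ i ≤ n) :
    pext n σ i = (σ ⟨i - 1, by omega⟩ : ℕ) + 1 := dif_pos h

lemma pext_of_not_mem (σ : Equiv.Perm (Fin n)) {i : ℕ} (h : ¬ (1 ≤ i ∧ i ≤ n)) :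
    pext n σ i = 0 := dif_neg h

lemma pext_mem (σ : Equiv.Perm (Fin n)) {i : ℕ} (h : 1 ≤ i ∧ i ≤ n) :
    1 ≤ pext n σ i ∧ pext n σ i ≤ n := by
  rw [pext_of_mem σ h]
  have := (σ ⟨i - 1, by omega⟩).isLt
  omega

lemma pext_inj (σ : Equiv.Perm (Fin n)) {i j : ℕ} (hi : 1 ≤ i ∧ i ≤ n) (hj : 1 ≤ j ∧ j ≤ n)
    (h : pext n σ i = pext n σ j) : i = j := by
  rw [pext_of_mem σ hi, pext_of_mem σ hj, Nat.add_right_cancel_iff, Fin.val_inj,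
    σ.injective.eq_iff, Fin.mk.injEq] at h
  omega

lemma exists_pext_eq (σ : Equiv.Perm (Fin n)) {y : ℕ} (hy : 1 ≤ y ∧ y ≤ n) :
    ∃ i, (1 ≤ i ∧ i ≤ n) ∧ pext n σ i = y := by
  have hlt : y - 1 < n := by omega
  refine ⟨σ.symm ⟨y - 1, hlt⟩ + 1, ⟨by omega, (σ.symm ⟨y - 1, hlt⟩).isLt⟩, ?_⟩
  rw [pext_succ, Equiv.apply_symm_apply]
  simp
  omega

/-- The word `σ(0) σ(1) ⋯ σ(n+1)` of a permutation. -/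
def permWord (n : ℕ) (σ : Equiv.Perm (Fin n)) : List ℕ := (List.range' 0 (n + 2)).map (pext n σ)

lemma permWord_eq (σ : Equiv.Perm (Fin n)) :
    permWord n σ = 0 :: ((List.range' 1 n).map (pext n σ) ++ [0]) := by
  rw [permWord, List.range'_succ, List.range'_concat]
  simp [pext_of_not_mem]

lemma permWord_injective : Function.Injective (permWord n) := by
  intro σ τ h
  rw [permWord_eq, permWord_eq] at h
  simp only [List.cons.injEq, true_and, List.append_cancel_right_eq] at h
  ext i
  have := List.map_inj_left.1 h (i + 1) (by simp; omega)
  rw [pext_succ, pext_succ] at this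
  omega

lemma isConf_permWord (hn : 1 ≤ n) (σ : Equiv.Perm (Fin n)) : IsConf n 1 0 (permWord n σ) := by
  refine ⟨fun y => ?_, ?_, ?_, ?_⟩
  · have hnd : ((List.range' 1 n).map (pext n σ)).Nodup := by
      refine List.Nodup.map_on ?_ List.nodup_range'
      intro i hi j hj h
      rw [List.mem_range'_1] at hi hj
      exact pext_inj σ (by omega) (by omega) h
    have hmem : y ∈ (List.range' 1 n).map (pext n σ) ↔ 0 < y ∧ y ≤ n := by
      rw [List.mem_map]
      constructor
      · rintro ⟨i, hi, rfl⟩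
        rw [List.mem_range'_1] at hi
        exact pext_mem σ (by omega)
      · intro hy
        obtain ⟨i, hi, h⟩ := exists_pext_eq σ hy
        exact ⟨i, by rw [List.mem_range'_1]; omega, h⟩
    rw [permWord_eq, List.count_cons, List.count_append, hnd.count]
    simp only [hmem]
    by_cases hy : y = 0
    · simp [hy]
    · simp [hy, Ne.symm hy]
  · rw [List.isChain_iff_getElem]
    intro i hi
    simp only [permWord, List.length_map, List.length_range'] at hi
    simp only [permWord, List.getElem_map, List.getElem_range']
    by_cases h : i = 0
    · right
      have := pext_mem σ (i := 0 + 1 * (i + 1)) (by omega)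
      omega
    · left
      have := pext_mem σ (i := 0 + 1 * i) (by omega)
      omega
  · simp [permWord_eq]
  · rw [permWord_eq, ← List.cons_append, List.getLast?_concat]

lemma exists_permWord_eq {L : List ℕ} (h : IsConf n 1 0 L) : ∃ σ, permWord n σ = L := by
  obtain ⟨L, rfl⟩ := List.head?_eq_some_iff.1 h.2.2.1
  rcases List.eq_nil_or_concat L with rfl | ⟨M, a, rfl⟩
  · simpa using h.1 0
  obtain rfl : a = 0 := by simpa [List.getLast?_cons] using h.2.2.2
  have hcount : ∀ y, M.count y = if 0 < y ∧ y ≤ n then 1 else 0 := by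
    intro y
    have := h.1 y
    by_cases hy : y = 0
    · simpa [hy] using this
    · simpa [hy, Ne.symm hy] using this
  have hnd : M.Nodup := List.nodup_iff_count_le_one.2 fun y => by
    rw [hcount]
    split_ifs <;> omega
  have hmem : ∀ y, y ∈ M ↔ 0 < y ∧ y ≤ n := fun y => by
    rw [← List.count_pos_iff, hcount]
    split_ifs <;> simp [*]
  have hlen : M.length = n := by
    have hM : M.toFinset = Finset.Icc 1 n := by
      ext y
      rw [List.mem_toFinset, hmem, Finset.mem_Icc]
      omega
    rw [← List.toFinset_card_of_nodup hnd, hM, Nat.card_Icc, Nat.add_sub_cancel]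
  have hget : ∀ i : Fin n, 0 < M[(i : ℕ)] ∧ M[(i : ℕ)] ≤ n :=
    fun i => (hmem _).1 (List.getElem_mem _)
  let f : Fin n → Fin n := fun i => ⟨M[(i : ℕ)] - 1, by have := hget i; omega⟩
  have hf : Function.Injective f := by
    intro i j hij
    have hi := hget i
    have hj := hget j
    simp only [f, Fin.mk.injEq] at hij
    exact Fin.ext ((hnd.getElem_inj_iff).1 (by omega))
  refine ⟨Equiv.ofBijective f (Finite.injective_iff_bijective.1 hf), ?_⟩
  rw [permWord_eq, List.concat_eq_append]
  congr 2
  refine List.ext_getElem (by simp [hlen]) fun i h1 h2 => ?_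
  have hi : i < n := by omega
  have := pext_succ (Equiv.ofBijective f (Finite.injective_iff_bijective.1 hf)) ⟨i, hi⟩
  simp only [List.getElem_map, List.getElem_range', one_mul]
  rw [add_comm, this]
  have := hget ⟨i, hi⟩
  simp [f] at this ⊢
  omega

lemma sum_wordWt_permWord {R : Type*} [CommRing R] {p q t : R} (hn : 1 ≤ n) :
    ∑ σ : Equiv.Perm (Fin n), wordWt p q t [] (permWord n σ) = pathSum p q t 1 n := by
  rw [← confSum_eq_pathSum (n := n) n 1 0 (by omega)]
  refine Finset.sum_bij (fun σ _ => permWord n σ) (fun σ _ => mem_confs.2 (isConf_permWord hn σ))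
    (fun _ _ _ _ h => permWord_injective h) (fun L hL => ?_) (fun _ _ => rfl)
  obtain ⟨σ, h⟩ := exists_permWord_eq (mem_confs.1 hL)
  exact ⟨σ, Finset.mem_univ _, h⟩

end PermWord

section WordStatistics

lemma ups_map_range' (f : ℕ → ℕ) (y m : ℕ) (a : ℕ) :
    ups y (decide (f a < y)) ((List.range' (a + 1) m).map f) =
      ∑ j ∈ Finset.Ico a (a + m), if f j < y ∧ y < f (j + 1) then 1 else 0 := by
  induction m generalizing a with
  | zero => simp [ups]
  | succ m ih =>
    rw [List.range'_succ, List.map_cons, ups, ih (a + 1),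
      Finset.sum_eq_sum_Ico_succ_bot (by omega : a < a + (m + 1)),
      show a + (m + 1) = a + 1 + m by omega]
    congr 1
    by_cases h1 : f a < y <;> by_cases h2 : y < f (a + 1) <;> simp [h1, h2]

lemma downs_map_range' (f : ℕ → ℕ) (y m : ℕ) (a : ℕ) :
    downs y (decide (y < f a)) ((List.range' (a + 1) m).map f) =
      ∑ j ∈ Finset.Ico (a + 1) (a + 1 + m), if f j < y ∧ y < f (j - 1) then 1 else 0 := by
  induction m generalizing a with
  | zero => simp [downs]
  | succ m ih =>
    rw [List.range'_succ, List.map_cons, downs, ih (a + 1),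
      Finset.sum_eq_sum_Ico_succ_bot (by omega : a + 1 < a + 1 + (m + 1)),
      show a + 1 + (m + 1) = a + 1 + 1 + m by omega]
    congr 1
    by_cases h1 : y < f a <;> by_cases h2 : f (a + 1) < y <;> simp [h1, h2]

variable {R : Type*} [CommRing R] {p q t : R} {n : ℕ}

lemma wordWt_map_range' (f : ℕ → ℕ) (N m a : ℕ) (h : a + m = N) :
    wordWt p q t ((List.range' 0 a).map f) ((List.range' a m).map f) =
      ∏ j ∈ Finset.Ico a N, posWt p q t ((List.range' 0 j).map f) (f j)
        ((List.range' (j + 1) (N - 1 - j)).map f) := by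
  induction m generalizing a with
  | zero =>
    subst h
    simp [wordWt]
  | succ m ih =>
    have := ih (a + 1) (by omega)
    rw [List.range'_concat] at this
    simp only [List.map_append, List.map_cons, List.map_nil, one_mul, zero_add] at this
    rw [List.range'_succ, List.map_cons, wordWt, this,
      Finset.prod_eq_prod_Ico_succ_bot (by omega : a < N), show N - 1 - a = m by omega]

lemma pext_ne {σ : Equiv.Perm (Fin n)} {i j : ℕ} (hi : 1 ≤ i ∧ i ≤ n) (hij : i ≠ j) :
    pext n σ i ≠ pext n σ j := by
  intro h
  by_cases hj : 1 ≤ j ∧ j ≤ n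
  · exact hij (pext_inj σ hi hj h)
  · have := pext_mem σ hi
    rw [pext_of_not_mem σ hj] at h
    omega

lemma resStat_eq_sum (σ : Equiv.Perm (Fin n)) :
    resStat n σ = ∑ i ∈ Finset.Icc 1 n, ∑ j ∈ Finset.Ico (i + 1) (n + 1),
      if pext n σ j < pext n σ i ∧ pext n σ i < pext n σ (j + 1) then 1 else 0 := by
  rw [resStat, pairs, Finset.card_filter, Finset.sum_product]
  refine Finset.sum_congr rfl fun i hi => ?_
  rw [← Finset.card_filter, ← Finset.card_filter]
  congr 1
  ext j
  simp only [Finset.mem_filter, Finset.mem_Icc, Finset.mem_Ico]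
  constructor
  · rintro ⟨h1, h2, h3, h4⟩
    exact ⟨by omega, h4⟩
  · rintro ⟨h1, h2, h3⟩
    have : j ≠ n := by
      rintro rfl
      rw [pext_of_not_mem σ (by omega : ¬ (1 ≤ j + 1 ∧ _))] at h3
      omega
    exact ⟨by omega, by omega, by omega, h2, h3⟩

lemma lesStat_eq_sum (σ : Equiv.Perm (Fin n)) :
    lesStat n σ = ∑ i ∈ Finset.Icc 1 n, ∑ j ∈ Finset.Ico 1 i,
      if pext n σ j < pext n σ i ∧ pext n σ i < pext n σ (j - 1) then 1 else 0 := by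
  rw [lesStat, pairs, Finset.card_filter, Finset.sum_product_right]
  refine Finset.sum_congr rfl fun i hi => ?_
  rw [← Finset.card_filter, ← Finset.card_filter]
  congr 1
  ext j
  rw [Finset.mem_Icc] at hi
  simp only [Finset.mem_filter, Finset.mem_Icc, Finset.mem_Ico]
  constructor
  · rintro ⟨h1, h2, h3, h4⟩
    exact ⟨by omega, h4⟩
  · rintro ⟨h1, h2, h3⟩
    have : j ≠ 1 := by
      rintro rfl
      rw [pext_of_not_mem σ (by omega : ¬ (1 ≤ 1 - 1 ∧ _))] at h3
      omega
    exact ⟨by omega, by omega, by omega, h2, h3⟩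

lemma posWt_permWord (σ : Equiv.Perm (Fin n)) {i : ℕ} (hi : 1 ≤ i ∧ i ≤ n) :
    posWt p q t ((List.range' 0 i).map (pext n σ)) (pext n σ i)
        ((List.range' (i + 1) (n + 2 - 1 - i)).map (pext n σ)) =
      p ^ (∑ j ∈ Finset.Ico (i + 1) (n + 1),
          if pext n σ j < pext n σ i ∧ pext n σ i < pext n σ (j + 1) then 1 else 0) *
        q ^ (∑ j ∈ Finset.Ico 1 i,
          if pext n σ j < pext n σ i ∧ pext n σ i < pext n σ (j - 1) then 1 else 0) *
        letterWt t (pext n σ (i - 1)) (pext n σ i) (pext n σ (i + 1)) := by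
  have h0 : pext n σ i ≠ 0 := by
    have := pext_mem σ hi
    omega
  obtain ⟨m, rfl⟩ : ∃ m, n = i + m := ⟨n - i, by omega⟩
  obtain ⟨k, rfl⟩ : ∃ k, i = k + 1 := ⟨i - 1, by omega⟩
  rw [posWt, if_neg h0, show k + 1 + m + 2 - 1 - (k + 1) = m + 1 by omega]
  congr 1
  · congr 2
    · rw [List.range'_succ, List.map_cons, ups, ups_map_range']
      simp [add_comm, add_left_comm]
    · rw [List.range'_succ, List.map_cons, downs, downs_map_range']
      simp [add_comm]
  · congr 1
    simp [List.range'_concat]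

lemma prod_letterWt (σ : Equiv.Perm (Fin n)) :
    ∏ i ∈ Finset.Icc 1 n, letterWt t (pext n σ (i - 1)) (pext n σ i) (pext n σ (i + 1)) =
      t ^ valleyStar n σ * (1 + t) ^ daStar n σ * 0 ^ ddStar n σ := by
  rw [valleyStar, daStar, ddStar, ← Finset.prod_const, ← Finset.prod_const, ← Finset.prod_const,
    Finset.prod_filter, Finset.prod_filter, Finset.prod_filter, ← Finset.prod_mul_distrib,
    ← Finset.prod_mul_distrib]
  refine Finset.prod_congr rfl fun i hi => ?_
  rw [Finset.mem_Icc] at hi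
  have h1 := pext_ne (σ := σ) hi (by omega : i ≠ i - 1)
  have h2 := pext_ne (σ := σ) hi (by omega : i ≠ i + 1)
  rw [letterWt]
  rcases lt_or_gt_of_ne h1 with h1 | h1 <;> rcases lt_or_gt_of_ne h2 with h2 | h2 <;>
    simp [h1, h2, h1.not_gt, h2.not_gt]

lemma wordWt_permWord (σ : Equiv.Perm (Fin n)) :
    wordWt p q t [] (permWord n σ) = p ^ resStat n σ * q ^ lesStat n σ *
      (t ^ valleyStar n σ * (1 + t) ^ daStar n σ * 0 ^ ddStar n σ) := by
  have h := wordWt_map_range' (p := p) (q := q) (t := t) (pext n σ) (n + 2) (n + 2) 0 (by omega)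
  rw [List.range'_zero, List.map_nil] at h
  rw [permWord, h, Finset.prod_Ico_succ_top (by omega),
    Finset.prod_eq_prod_Ico_succ_bot (by omega), pext_of_not_mem σ (by omega : ¬ (1 ≤ 0 ∧ _)),
    pext_of_not_mem σ (by omega : ¬ (1 ≤ n + 1 ∧ _)), posWt, if_pos rfl, posWt, if_pos rfl,
    one_mul, mul_one, zero_add, Finset.Ico_add_one_right_eq_Icc, resStat_eq_sum, lesStat_eq_sum,
    ← prod_letterWt, ← Finset.prod_pow_eq_pow_sum, ← Finset.prod_pow_eq_pow_sum,
    ← Finset.prod_mul_distrib, ← Finset.prod_mul_distrib]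
  exact Finset.prod_congr rfl fun i hi => posWt_permWord σ (Finset.mem_Icc.1 hi)

end WordStatistics

section Grouping

variable {n : ℕ}

lemma two_mul_valleyStar_add (hn : 1 ≤ n) (σ : Equiv.Perm (Fin n)) :
    2 * valleyStar n σ + daStar n σ + ddStar n σ = n - 1 := by
  let a : ℕ → ℕ := fun i => if pext n σ i < pext n σ (i + 1) then 1 else 0
  have h0 : a 0 = 1 := if_pos <| by
    have := pext_mem σ (i := 0 + 1) (by omega)
    rw [pext_of_not_mem σ (by omega : ¬ (1 ≤ 0 ∧ _))]
    omega
  have hlast : a n = 0 := if_neg <| by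
    rw [pext_of_not_mem σ (by omega : ¬ (1 ≤ n + 1 ∧ _))]
    omega
  have hterm : ∀ i ∈ Finset.Icc 1 n,
      2 * (if pext n σ i < pext n σ (i - 1) ∧ pext n σ i < pext n σ (i + 1) then 1 else 0) +
        (if pext n σ (i - 1) < pext n σ i ∧ pext n σ i < pext n σ (i + 1) then 1 else 0) +
        (if pext n σ (i + 1) < pext n σ i ∧ pext n σ i < pext n σ (i - 1) then 1 else 0) +
        a (i - 1) = 1 + a i := by
    intro i hi
    rw [Finset.mem_Icc] at hi
    have h1 := pext_ne (σ := σ) hi (by omega : i ≠ i - 1)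
    have h2 := pext_ne (σ := σ) hi (by omega : i ≠ i + 1)
    simp only [a, show i - 1 + 1 = i by omega]
    rcases lt_or_gt_of_ne h1 with h1 | h1 <;> rcases lt_or_gt_of_ne h2 with h2 | h2 <;>
      simp [h1, h2, h1.not_gt, h2.not_gt]
  have hsum := Finset.sum_congr (rfl : Finset.Icc 1 n = _) hterm
  simp only [Finset.sum_add_distrib, ← Finset.mul_sum, ← Finset.card_filter] at hsum
  have e1 : ∑ i ∈ Finset.Icc 1 n, a (i - 1) = ∑ i ∈ Finset.range n, a i := by
    rw [← Finset.Ico_add_one_right_eq_Icc, Finset.sum_Ico_eq_sum_range]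
    simp
  have e2 : ∑ i ∈ Finset.Icc 1 n, a i + a 0 = ∑ i ∈ Finset.range n, a i + a n := by
    rw [← Finset.sum_range_succ, Finset.sum_range_succ', ← Finset.Ico_add_one_right_eq_Icc,
      Finset.sum_Ico_eq_sum_range]
    simp [add_comm]
  simp only [Finset.sum_const, Nat.card_Icc, smul_eq_mul, mul_one, e1] at hsum
  rw [valleyStar, daStar, ddStar]
  omega

open MvPolynomial in
lemma sum_aPoly3t (hn : 1 ≤ n) :
    ∑ k ∈ Finset.range ((n - 1) / 2 + 1),
        aPoly3t n k * X 2 ^ (k + 1) * (1 + X 2) ^ (n - 1 - 2 * k) =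
      X 2 * ∑ σ : Equiv.Perm (Fin n), wordWt (X 0) (X 1) (X 2) [] (permWord n σ) := by
  simp only [aPoly3t, Finset.sum_filter, Finset.sum_mul]
  rw [Finset.sum_comm, Finset.mul_sum]
  refine Finset.sum_congr rfl fun σ _ => ?_
  have h := two_mul_valleyStar_add hn σ
  rw [wordWt_permWord, Finset.sum_eq_single (valleyStar n σ)]
  · by_cases hdd : ddStar n σ = 0
    · rw [if_pos ⟨rfl, hdd⟩, hdd, show n - 1 - 2 * valleyStar n σ = daStar n σ by omega]
      ring
    · simp [hdd]
  · intro k _ hk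
    rw [if_neg fun hh => hk hh.1.symm]
    simp
  · intro hk
    rw [Finset.mem_range] at hk
    omega

end Grouping

open MvPolynomial in
theorem statement5 (n : ℕ) (hn : 1 ≤ n) :
    (∑ σ : Equiv.Perm (Fin n),
        (X 0 : MvPolynomial (Fin 3) ℤ) ^ nestStat n σ * X 1 ^ crosStat n σ *
          X 2 ^ wexStat n σ) =
      ∑ k ∈ Finset.range ((n - 1) / 2 + 1),
        aPoly3t n k * X 2 ^ (k + 1) * (1 + X 2) ^ (n - 1 - 2 * k) := by
  obtain ⟨m, rfl⟩ : ∃ m, n = m + 1 := ⟨n - 1, by omega⟩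
  rw [sum_nest_cros_wex_eq_pathSum, sum_aPoly3t hn, sum_wordWt_permWord hn]

end SZpaper
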